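/- For all constants c_1, c_2 > 0 there exists a constant K > 0 such that the following holds. Let p be a prime, let C ⊆ F_p, and let Y ⊆ F_p \ {0} with |Y| ≤ c_1 |C|^2 and |C|^2 |Y| ≤ c_2 p^2. Then Σ_{y ∈ Y} E^+(C, yC) ≤ K · E^+(C)^{1/2} |C|^{3/2} |Y|^{3/4}. -/

import Mathlib

/-- `addEnergy2 A B` is `E^+(A, B) = #{(a, b, a', b') ∈ A × B × A × B : a + b = a' + b'}`. -/
noncomputable def addEnergy2 {F : Type*} [Add F] (A B : Set F) : ℕ :=
  {t : F × F × F × F | t.1 ∈ A ∧ t.2.1 ∈ B ∧ t.2.2.1 ∈ A ∧ t.2.2.2 ∈ B ∧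
      t.1 + t.2.1 = t.2.2.1 + t.2.2.2}.ncard

/-- `addEnergy C` is the additive energy `E^+(C) = E^+(C, C)`. -/
noncomputable def addEnergy {F : Type*} [Add F] (C : Set F) : ℕ := addEnergy2 C C

theorem Polynomial.resultant_ne_zero_of_irreducible_of_not_dvd {R : Type*} [CommRing R] [IsDomain R]
    [UniqueFactorizationMonoid R] {f g : Polynomial R} (hf : Irreducible f)
    (hdeg : f.natDegree ≠ 0) (hg : ¬ f ∣ g) : f.resultant g ≠ 0 := by
  classical
  let : NormalizationMonoid R := Classical.choice inferInstance
  let : NormalizedGCDMonoid R := Classical.choice inferInstance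
  have hinj : Function.Injective (algebraMap R (FractionRing R)) := IsFractionRing.injective R _
  intro h0
  have h1 := Polynomial.resultant_map_map f g f.natDegree g.natDegree
    (algebraMap R (FractionRing R))
  rw [h0, map_zero] at h1
  have h2 : (f.map (algebraMap R (FractionRing R))).resultant
      (g.map (algebraMap R (FractionRing R))) = 0 := by
    rw [← h1, Polynomial.natDegree_map_eq_of_injective hinj,
      Polynomial.natDegree_map_eq_of_injective hinj]
  rw [Polynomial.resultant_eq_zero_iff] at h2
  have hirr := ((hf.isPrimitive hdeg).irreducible_iff_irreducible_map_fraction_map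
    (K := FractionRing R)).1 hf
  obtain ⟨q, hq⟩ := not_not.1 (mt hirr.coprime_iff_not_dvd.2 h2.2)
  obtain ⟨b, hb, hbq⟩ := IsLocalization.integerNormalization_spec (nonZeroDivisors R) q
  set q' := IsLocalization.integerNormalization (nonZeroDivisors R) q
  have h3 : f * q' = Polynomial.C b * g := by
    apply Polynomial.map_injective _ hinj
    rw [Polynomial.map_mul, Polynomial.map_mul, hbq, hq, Polynomial.map_C, ← algebraMap_smul
      (FractionRing R) b q, Polynomial.smul_eq_C_mul]
    ring
  have hp : Prime f := hf.prime
  rcases hp.dvd_or_dvd (Dvd.intro _ h3) with h | h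
  · have := Polynomial.natDegree_le_of_dvd h (by simpa using nonZeroDivisors.ne_zero hb)
    simp at this
    omega
  · exact hg h

open MvPolynomial in
theorem MvPolynomial.exists_elimination {K : Type*} [Field K] {n : ℕ}
    {f g : MvPolynomial (Fin (n + 1)) K} (hf : Irreducible f) (hdeg : f.degreeOf 0 ≠ 0)
    (hg : ¬ f ∣ g) :
    ∃ c : MvPolynomial (Fin n) K, c ≠ 0 ∧ c.totalDegree ≤ 2 * f.totalDegree * g.totalDegree ∧
      ∀ (s : Fin n → K) (w : K), eval (Fin.cons w s) f = 0 → eval (Fin.cons w s) g = 0 →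
        eval s c = 0 := by
  classical
  set f' := finSuccEquiv K n f with hf'
  set g' := finSuccEquiv K n g with hg'
  have hdf : f'.natDegree ≤ f.totalDegree := by
    rw [hf', natDegree_finSuccEquiv]; exact degreeOf_le_totalDegree _ _
  have hdg : g'.natDegree ≤ g.totalDegree := by
    rw [hg', natDegree_finSuccEquiv]; exact degreeOf_le_totalDegree _ _
  have hcf (i : ℕ) : (f'.coeff i).totalDegree ≤ f.totalDegree := by
    by_cases h : f'.coeff i = 0
    · simp [h]
    · exact (Nat.le_add_right _ i).trans (totalDegree_coeff_finSuccEquiv_add_le f i h)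
  have hcg (i : ℕ) : (g'.coeff i).totalDegree ≤ g.totalDegree := by
    by_cases h : g'.coeff i = 0
    · simp [h]
    · exact (Nat.le_add_right _ i).trans (totalDegree_coeff_finSuccEquiv_add_le g i h)
  have hn : f'.natDegree ≠ 0 := by rwa [hf', natDegree_finSuccEquiv]
  refine ⟨f'.resultant g', ?_, ?_, ?_⟩
  · apply Polynomial.resultant_ne_zero_of_irreducible_of_not_dvd _ hn
    · rwa [hf', hg', map_dvd_iff]
    · rwa [hf', MulEquiv.irreducible_iff]
  · rw [Polynomial.resultant, Matrix.det_apply]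
    refine totalDegree_finsetSum_le fun σ _ => ?_
    refine (totalDegree_smul_le _ _).trans ?_
    refine (totalDegree_finsetProd _ _).trans ?_
    rw [Fin.sum_univ_add]
    have h1 : ∀ i : Fin f'.natDegree, (Polynomial.sylvester f' g' f'.natDegree g'.natDegree
        (σ (Fin.castAdd _ i)) (Fin.castAdd _ i)).totalDegree ≤ g.totalDegree := by
      intro i
      simp only [Polynomial.sylvester, Matrix.of_apply, Fin.addCases_left]
      split_ifs
      · exact hcg _
      · simp
    have h2 : ∀ i : Fin g'.natDegree, (Polynomial.sylvester f' g' f'.natDegree g'.natDegree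
        (σ (Fin.natAdd _ i)) (Fin.natAdd _ i)).totalDegree ≤ f.totalDegree := by
      intro i
      simp only [Polynomial.sylvester, Matrix.of_apply, Fin.addCases_right]
      split_ifs
      · exact hcf _
      · simp
    refine (add_le_add (Finset.sum_le_sum fun i _ => h1 i)
      (Finset.sum_le_sum fun i _ => h2 i)).trans ?_
    simp only [Finset.sum_const, Finset.card_univ, Fintype.card_fin, smul_eq_mul]
    calc _ ≤ f.totalDegree * g.totalDegree + g.totalDegree * f.totalDegree := by gcongr
      _ = _ := by ring
  · intro s w h1 h2
    obtain ⟨p, q, -, -, h⟩ := Polynomial.exists_mul_add_mul_eq_C_resultant f' g' le_rfl le_rfl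
      (Or.inl hn)
    rw [eval_eq_eval_mv_eval', ← hf'] at h1
    rw [eval_eq_eval_mv_eval', ← hg'] at h2
    have := congrArg (fun x => Polynomial.eval w (Polynomial.map (eval s) x)) h
    simpa [h1, h2] using this.symm

namespace MvPolynomial

variable {K : Type*} [Field K]

theorem eval_line_eq_zero {σ : Type*} (f : MvPolynomial σ K) (u v : σ → K) (S : Finset K)
    (hS : ∀ t ∈ S, eval (fun i => u i + v i * t) f = 0) (hcard : f.totalDegree < S.card) (t : K) :
    eval (fun i => u i + v i * t) f = 0 := by
  set g : σ → Polynomial K := fun i => Polynomial.C (u i) + Polynomial.C (v i) * Polynomial.X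
  have hev (t : K) : (aeval g f).eval t = eval (fun i => u i + v i * t) f := by
    rw [aeval_def, polynomial_eval_eval₂, eval, coe_eval₂Hom]
    congr 1
    · ext x; simp
    · ext i; simp [g]
  have hdeg : (aeval g f).natDegree ≤ f.totalDegree := by
    have := aeval_natDegree_le f le_rfl g (n := 1) fun i => by
      simp only [g]; compute_degree
    simpa using this
  have h0 : aeval g f = 0 := by
    apply Polynomial.eq_zero_of_natDegree_lt_card_of_eval_eq_zero' _ S
    · intro t ht; rw [hev, hS t ht]
    · omega
  rw [← hev, h0, Polynomial.eval_zero]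

theorem degreeOf_eq_zero_of_pderiv_eq_zero {σ : Type*} {p : ℕ} [CharP K p] (f : MvPolynomial σ K)
    (i : σ) (hdeg : f.totalDegree < p) (h : pderiv i f = 0) : f.degreeOf i = 0 := by
  classical
  by_contra hne
  obtain ⟨m, hm, hmi⟩ : ∃ m ∈ f.support, m i ≠ 0 := by
    by_contra! hcon
    apply hne
    rw [← Nat.le_zero, degreeOf_le_iff]
    intro m hm
    exact (hcon m hm).le
  have hle : m i ≤ f.totalDegree :=
    (degreeOf_le_iff.1 le_rfl m hm).trans (degreeOf_le_totalDegree f i)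
  have h1 := coeff_pderiv f (i := i) (m - Finsupp.single i 1)
  have h2 : m - Finsupp.single i 1 + Finsupp.single i 1 = m := by
    apply tsub_add_cancel_of_le
    simp; omega
  rw [h, coeff_zero, h2, eq_comm, mul_eq_zero] at h1
  rcases h1 with h1 | h1
  · exact (mem_support_iff.1 hm) h1
  · have h3 : ((m i : ℕ) : K) = 0 := by
      rw [← h1, ← Nat.cast_add_one]
      congr 1
      simp; omega
    rw [CharP.cast_eq_zero_iff K p] at h3
    have := Nat.le_of_dvd (by omega) h3
    omega

theorem totalDegree_pderiv_le {σ : Type*} (f : MvPolynomial σ K) (i : σ) :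
    (pderiv i f).totalDegree ≤ f.totalDegree - 1 := by
  classical
  refine Finset.sup_le fun m hm => ?_
  rw [mem_support_iff, coeff_pderiv] at hm
  have h1 := le_totalDegree (mem_support_iff.2 (left_ne_zero_of_mul hm))
  rw [Finsupp.sum_add_index' (fun _ => rfl) (fun _ _ _ => rfl),
    Finsupp.sum_single_index rfl] at h1
  omega

theorem eval_cons_of_degreeOf_eq_zero {n : ℕ} (f : MvPolynomial (Fin (n + 1)) K)
    (h : f.degreeOf 0 = 0) (s : Fin n → K) (w w' : K) :
    eval (Fin.cons w s) f = eval (Fin.cons w' s) f := by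
  rw [← natDegree_finSuccEquiv] at h
  rw [eval_eq_eval_mv_eval', eval_eq_eval_mv_eval', Polynomial.eq_C_of_natDegree_eq_zero h]
  simp

theorem eval_line_eq_zero_of_lines (f : MvPolynomial (Fin 2) K) (S : Finset K)
    (hS : ∀ b ∈ S, ∀ a, eval ![a, b] f = 0) (hcard : f.totalDegree < S.card) [Infinite K] :
    f = 0 := by
  apply MvPolynomial.funext
  intro x
  have h (a b : K) : (fun i => (![a, 0] : Fin 2 → K) i + (![0, 1] : Fin 2 → K) i * b) =
      ![a, b] := by
    ext i; fin_cases i <;> simp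
  have := eval_line_eq_zero f ![x 0, 0] ![0, 1] S (fun b hb => by rw [h]; exact hS b hb _) hcard
    (x 1)
  rw [h] at this
  rw [map_zero, ← this]
  refine congrArg (fun y => eval y f) ?_
  ext i; fin_cases i <;> simp

/-- The zero set of `f` contains the line `{(m₁ a + m₃, a, m₂)}`. -/
def VanishesOnDualLine (f : MvPolynomial (Fin 3) K) (h : K × K × K) : Prop :=
  ∀ a, eval ![h.1 * a + h.2.2, a, h.2.1] f = 0

/-- The zero set of `f` contains the line `{(p₃ - p₂ b, p₁, b)}`. -/
def VanishesOnLine (f : MvPolynomial (Fin 3) K) (p : K × K × K) : Prop :=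
  ∀ b, eval ![p.2.2 - p.2.1 * b, p.1, b] f = 0

theorem vanishesOnDualLine_of_card (f : MvPolynomial (Fin 3) K) (h : K × K × K) (S : Finset K)
    (hS : ∀ a ∈ S, eval ![h.1 * a + h.2.2, a, h.2.1] f = 0) (hcard : f.totalDegree < S.card) :
    VanishesOnDualLine f h := by
  have H (a : K) : (fun i => (![h.2.2, 0, h.2.1] : Fin 3 → K) i + (![h.1, 1, 0] : Fin 3 → K) i * a)
      = ![h.1 * a + h.2.2, a, h.2.1] := by
    ext i; fin_cases i <;> simp; ring
  intro a
  have := eval_line_eq_zero f ![h.2.2, 0, h.2.1] ![h.1, 1, 0] S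
    (fun b hb => by rw [H]; exact hS b hb) hcard a
  rwa [H] at this

theorem vanishesOnLine_of_card (f : MvPolynomial (Fin 3) K) (p : K × K × K) (S : Finset K)
    (hS : ∀ b ∈ S, eval ![p.2.2 - p.2.1 * b, p.1, b] f = 0) (hcard : f.totalDegree < S.card) :
    VanishesOnLine f p := by
  have H (b : K) : (fun i => (![p.2.2, p.1, 0] : Fin 3 → K) i + (![-p.2.1, 0, 1] : Fin 3 → K) i * b)
      = ![p.2.2 - p.2.1 * b, p.1, b] := by
    ext i; fin_cases i <;> simp; ring
  intro b
  have := eval_line_eq_zero f ![p.2.2, p.1, 0] ![-p.2.1, 0, 1] S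
    (fun b hb => by rw [H]; exact hS b hb) hcard b
  rwa [H] at this

theorem card_le_of_vanishesOnDualLine [Infinite K] {f g : MvPolynomial (Fin 3) K}
    (hf : Irreducible f) (hdeg : f.degreeOf 0 ≠ 0) (hg : ¬ f ∣ g) (H : Finset (K × K × K))
    (hinj : Set.InjOn (fun h : K × K × K => h.2.1) H) (hHf : ∀ h ∈ H, VanishesOnDualLine f h)
    (hHg : ∀ h ∈ H, VanishesOnDualLine g h) :
    H.card ≤ 2 * f.totalDegree * g.totalDegree := by
  classical
  obtain ⟨c, hc, hcd, hcv⟩ := exists_elimination hf hdeg hg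
  by_contra! hlt
  apply hc
  apply eval_line_eq_zero_of_lines c (H.image fun h => h.2.1)
  · intro b hb a
    obtain ⟨h, hh, rfl⟩ := Finset.mem_image.1 hb
    exact hcv _ (h.1 * a + h.2.2) (hHf h hh a) (hHg h hh a)
  · rw [Finset.card_image_of_injOn hinj]
    omega

theorem card_le_of_vanishesOnDualLine_of_degreeOf_eq_zero [Infinite K]
    {f : MvPolynomial (Fin 3) K} (hf : f ≠ 0) (hdeg : f.degreeOf 0 = 0)
    (H : Finset (K × K × K)) (hinj : Set.InjOn (fun h : K × K × K => h.2.1) H)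
    (hHf : ∀ h ∈ H, VanishesOnDualLine f h) : H.card ≤ f.totalDegree := by
  classical
  by_contra! hlt
  apply hf
  apply MvPolynomial.funext
  intro x
  have h0 (w a b : K) : eval ![w, a, b] f = eval ![0, a, b] f :=
    eval_cons_of_degreeOf_eq_zero f hdeg ![a, b] w 0
  have := vanishesOnLine_of_card f (x 1, 0, x 0) (H.image fun h => h.2.1) (by
    intro b hb
    obtain ⟨h, hh, rfl⟩ := Finset.mem_image.1 hb
    have := hHf h hh (x 1)
    rw [h0] at this ⊢
    exact this) (by rwa [Finset.card_image_of_injOn hinj]) (x 2)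
  rw [map_zero, ← this]
  refine congrArg (fun y => eval y f) ?_
  ext i; fin_cases i <;> simp

end MvPolynomial

open MvPolynomial in
theorem Derivation.map_mvPolynomial_aeval {K A σ : Type*} [CommRing K] [CommRing A] [Algebra K A]
    [Fintype σ] (D : Derivation K A A) (g : σ → A) (f : MvPolynomial σ K) :
    D (aeval g f) = ∑ i, aeval g (pderiv i f) * D (g i) := by
  classical
  induction f using MvPolynomial.induction_on with
  | C a => simp
  | add p q hp hq => simp only [map_add, hp, hq, add_mul, Finset.sum_add_distrib]
  | mul_X p j hp =>
    simp only [map_mul, Derivation.leibniz, hp, aeval_X, smul_eq_mul, map_add, pderiv_X, add_mul,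
      Finset.sum_add_distrib, Finset.mul_sum, Pi.single_apply]
    simp only [apply_ite (aeval g), map_one, map_zero, mul_ite, ite_mul, mul_one, mul_zero,
      zero_mul, Finset.sum_ite_eq, Finset.mem_univ, if_true]
    simp [mul_assoc]

/-- The derivation acting coefficientwise on polynomials. -/
noncomputable def Derivation.coeffwise {K A : Type*} [CommRing K] [CommRing A] [Algebra K A]
    (D : Derivation K A A) : Derivation K (Polynomial A) (Polynomial A) :=
  (PolynomialModule.equivPolynomialSelf (R := A)).toLinearMap.compDer D.mapCoeffs

theorem Derivation.coeff_coeffwise {K A : Type*} [CommRing K] [CommRing A] [Algebra K A]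
    (D : Derivation K A A) (f : Polynomial A) (i : ℕ) :
    (D.coeffwise f).coeff i = D (f.coeff i) := rfl

theorem Derivation.coeffwise_C {K A : Type*} [CommRing K] [CommRing A] [Algebra K A]
    (D : Derivation K A A) (a : A) :
    D.coeffwise (Polynomial.C a) = Polynomial.C (D a) := by
  ext i
  rw [D.coeff_coeffwise, Polynomial.coeff_C, Polynomial.coeff_C]
  split_ifs <;> simp

theorem Derivation.coeffwise_X {K A : Type*} [CommRing K] [CommRing A] [Algebra K A]
    (D : Derivation K A A) :
    D.coeffwise (Polynomial.X : Polynomial A) = 0 := by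
  ext i
  rw [D.coeff_coeffwise, Polynomial.coeff_X]
  split_ifs <;> simp

namespace MvPolynomial

variable {K : Type*} [Field K]

/-- The polynomial measuring the second order contact of the surface `f = 0` with the lines
tangent to it in the slices where the variable `1` is constant. -/
noncomputable def contactPoly (f : MvPolynomial (Fin 3) K) : MvPolynomial (Fin 3) K :=
  pderiv 0 f ^ 2 * pderiv 2 (pderiv 2 f) - 2 * pderiv 2 f * pderiv 0 f * pderiv 0 (pderiv 2 f)
    + pderiv 2 f ^ 2 * pderiv 0 (pderiv 0 f)

/-- The derivation along the level curves of `f` in the slices where the variable `1` is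
constant. -/
noncomputable def sliceDer (f : MvPolynomial (Fin 3) K) :
    Derivation K (MvPolynomial (Fin 3) K) (MvPolynomial (Fin 3) K) :=
  pderiv 0 f • pderiv 2 - pderiv 2 f • pderiv 0

theorem sliceDer_apply (f g : MvPolynomial (Fin 3) K) :
    sliceDer f g = pderiv 0 f * pderiv 2 g - pderiv 2 f * pderiv 0 g := rfl

theorem pderiv_comm' (f : MvPolynomial (Fin 3) K) :
    pderiv 2 (pderiv 0 f) = pderiv 0 (pderiv 2 f) := by
  have h : ⁅(pderiv 2 : Derivation K (MvPolynomial (Fin 3) K) (MvPolynomial (Fin 3) K)),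
      (pderiv 0 : Derivation K (MvPolynomial (Fin 3) K) (MvPolynomial (Fin 3) K))⁆ = 0 := by
    refine derivation_ext fun i => ?_
    rw [Derivation.commutator_apply]
    fin_cases i <;> simp [pderiv_X]
  have h1 := congrArg (fun D => D f) h
  simpa [Derivation.commutator_apply, sub_eq_zero] using h1

/-- Translation along the tangent direction of the slice. -/
noncomputable def tangentShift (f : MvPolynomial (Fin 3) K) :
    MvPolynomial (Fin 3) K →ₐ[K] Polynomial (MvPolynomial (Fin 3) K) :=
  aeval ![Polynomial.C (X 0) - Polynomial.X * Polynomial.C (pderiv 2 f), Polynomial.C (X 1),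
    Polynomial.C (X 2) + Polynomial.X * Polynomial.C (pderiv 0 f)]

theorem derivative_tangentShift (f g : MvPolynomial (Fin 3) K) :
    Polynomial.derivative (tangentShift f g) =
      Polynomial.C (pderiv 0 f) * tangentShift f (pderiv 2 g)
        - Polynomial.C (pderiv 2 f) * tangentShift f (pderiv 0 g) := by
  have := Derivation.map_mvPolynomial_aeval (Polynomial.derivative'.restrictScalars K :
    Derivation K (Polynomial (MvPolynomial (Fin 3) K)) (Polynomial (MvPolynomial (Fin 3) K)))
    ![Polynomial.C (X 0) - Polynomial.X * Polynomial.C (pderiv 2 f), Polynomial.C (X 1),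
    Polynomial.C (X 2) + Polynomial.X * Polynomial.C (pderiv 0 f)] g
  change Polynomial.derivative (tangentShift f g) = _ at this
  rw [this, Fin.sum_univ_three]
  simp [Polynomial.derivative', tangentShift]
  ring

theorem sliceDer_tangentShift (f g : MvPolynomial (Fin 3) K) :
    Polynomial.C (pderiv 0 f) * (sliceDer f).coeffwise (tangentShift f g) =
      Polynomial.C (pderiv 0 f) * Polynomial.derivative (tangentShift f g) + Polynomial.X *
        (Polynomial.C (sliceDer f (pderiv 0 f)) * Polynomial.derivative (tangentShift f g)
          - Polynomial.C (contactPoly f) * tangentShift f (pderiv 0 g)) := by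
  have := Derivation.map_mvPolynomial_aeval (sliceDer f).coeffwise
    ![Polynomial.C (X 0) - Polynomial.X * Polynomial.C (pderiv 2 f), Polynomial.C (X 1),
    Polynomial.C (X 2) + Polynomial.X * Polynomial.C (pderiv 0 f)] g
  change (sliceDer f).coeffwise (tangentShift f g) = _ at this
  simp only [← tangentShift.eq_1 f] at this
  rw [this, Fin.sum_univ_three, derivative_tangentShift]
  have hc : contactPoly f = pderiv 0 f * sliceDer f (pderiv 2 f) -
      pderiv 2 f * sliceDer f (pderiv 0 f) := by
    rw [contactPoly, sliceDer_apply, sliceDer_apply, pderiv_comm']; ring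
  have h0 : sliceDer f (X 0) = - pderiv 2 f := by simp [sliceDer_apply, pderiv_X]
  have h1 : sliceDer f (X 1) = 0 := by simp [sliceDer_apply, pderiv_X]
  have h2 : sliceDer f (X 2) = pderiv 0 f := by simp [sliceDer_apply, pderiv_X]
  rw [hc]
  simp only [Matrix.cons_val, map_sub, map_add, Derivation.leibniz, Derivation.coeffwise_C,
    Derivation.coeffwise_X, h0, h1, h2, smul_eq_mul, map_mul, map_neg, map_zero, mul_zero,
    add_zero]
  ring

theorem dvd_coeff_tangentShift {p : ℕ} [CharP K p] {f : MvPolynomial (Fin 3) K} (hf : Prime f)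
    (hw : ¬ f ∣ pderiv 0 f) (hc : f ∣ contactPoly f) (i : ℕ) (hi : i < p) :
    f ∣ (tangentShift f f).coeff i := by
  induction i with
  | zero =>
    have : (tangentShift f f).coeff 0 = f := by
      rw [Polynomial.coeff_zero_eq_eval_zero, tangentShift, aeval_def, polynomial_eval_eval₂]
      conv_rhs => rw [← eval₂_eta f]
      congr 1
      · ext x; simp
      · ext1 i; fin_cases i <;> simp
    rw [this]
  | succ i ih =>
    have h1 := congrArg (fun q => Polynomial.coeff q i) (sliceDer_tangentShift f f)
    have h2 : f ∣ (tangentShift f f).coeff i := ih (by omega)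
    have h3 : f ∣ sliceDer f ((tangentShift f f).coeff i) := by
      obtain ⟨q, hq⟩ := h2
      have : sliceDer f f = 0 := by rw [sliceDer_apply]; ring
      rw [hq, Derivation.leibniz, this]
      simp
    have hX : f ∣ (Polynomial.X *
        (Polynomial.C (sliceDer f (pderiv 0 f)) * Polynomial.derivative (tangentShift f f)
          - Polynomial.C (contactPoly f) * tangentShift f (pderiv 0 f))).coeff i := by
      rcases i with _ | j
      · simp
      · rw [Polynomial.coeff_X_mul, Polynomial.coeff_sub, Polynomial.coeff_C_mul,
          Polynomial.coeff_C_mul, Polynomial.coeff_derivative]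
        exact dvd_sub ((h2.mul_right _).mul_left _) (hc.mul_right _)
    simp only [Polynomial.coeff_add, Polynomial.coeff_C_mul, Derivation.coeff_coeffwise] at h1
    have h4 : f ∣ pderiv 0 f * (Polynomial.derivative (tangentShift f f)).coeff i := by
      rw [← dvd_add_left hX, ← h1]
      exact h3.mul_left _
    have h5 := (hf.dvd_or_dvd h4).resolve_left hw
    rw [Polynomial.coeff_derivative] at h5
    refine (hf.dvd_or_dvd h5).resolve_right fun h6 => ?_
    apply hf.not_isUnit
    apply isUnit_of_dvd_unit h6
    have h7 : ((i + 1 : ℕ) : K) ≠ 0 := by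
      rw [Ne, CharP.cast_eq_zero_iff K p]
      exact Nat.not_dvd_of_pos_of_lt (by omega) hi
    have := (isUnit_iff_ne_zero.2 h7).map (C : K →+* MvPolynomial (Fin 3) K)
    simpa using this

theorem eval_tangent_eq_zero {p : ℕ} [CharP K p] {f : MvPolynomial (Fin 3) K} (hf : Prime f)
    (hdeg : f.totalDegree < p) (hw : ¬ f ∣ pderiv 0 f) (hc : f ∣ contactPoly f) (q : Fin 3 → K)
    (hq : eval q f = 0) (t : K) :
    eval ![q 0 - t * eval q (pderiv 2 f), q 1, q 2 + t * eval q (pderiv 0 f)] f = 0 := by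
  set g : Fin 3 → Polynomial K := ![Polynomial.C (q 0) - Polynomial.X *
    Polynomial.C (eval q (pderiv 2 f)), Polynomial.C (q 1), Polynomial.C (q 2) + Polynomial.X *
    Polynomial.C (eval q (pderiv 0 f))] with hg
  have h1 : Polynomial.map (eval q) (tangentShift f f) = aeval g f := by
    rw [← Polynomial.coe_mapRingHom, tangentShift, map_aeval, aeval_def, coe_eval₂Hom]
    congr 1
    · ext x; simp
    · ext1 i; fin_cases i <;> simp [g]
  have h2 : (aeval g f).natDegree ≤ f.totalDegree := by
    have := aeval_natDegree_le f le_rfl g (n := 1) fun i => by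
      fin_cases i <;> simp only [g] <;> simp <;> compute_degree
    simpa using this
  have h3 : aeval g f = 0 := by
    ext i
    rcases lt_or_ge i p with h | h
    · rw [← h1, Polynomial.coeff_map, Polynomial.coeff_zero]
      obtain ⟨r, hr⟩ := dvd_coeff_tangentShift hf hw hc i h
      rw [hr, map_mul, hq, zero_mul]
    · exact Polynomial.coeff_eq_zero_of_natDegree_lt (by omega)
  have h4 := congrArg (Polynomial.eval t) h3
  rw [aeval_def, polynomial_eval_eval₂, Polynomial.eval_zero] at h4
  rw [← h4, eval, coe_eval₂Hom]
  congr 1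
  · ext x; simp
  · ext1 i; fin_cases i <;> simp [g] <;> ring

theorem VanishesOnLine.derivative [Infinite K] {f : MvPolynomial (Fin 3) K} {p : K × K × K}
    (hf : VanishesOnLine f p) :
    VanishesOnLine (pderiv 2 f - C p.2.1 * pderiv 0 f) p := by
  set g : Fin 3 → Polynomial K := ![Polynomial.C p.2.2 - Polynomial.C p.2.1 * Polynomial.X,
    Polynomial.C p.1, Polynomial.X] with hg
  have hev (h : MvPolynomial (Fin 3) K) (b : K) :
      (aeval g h).eval b = eval ![p.2.2 - p.2.1 * b, p.1, b] h := by
    rw [aeval_def, polynomial_eval_eval₂, eval, coe_eval₂Hom]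
    congr 1
    · ext x; simp
    · ext1 i; fin_cases i <;> simp [g]
  have h0 : aeval g f = 0 := Polynomial.funext fun b => by rw [hev, hf b, Polynomial.eval_zero]
  have h1 := Derivation.map_mvPolynomial_aeval
    (Polynomial.derivative' : Derivation K (Polynomial K) (Polynomial K)) g f
  rw [h0, map_zero, Fin.sum_univ_three] at h1
  intro b
  have h2 := congrArg (Polynomial.eval b) h1
  simp only [Polynomial.eval_add, Polynomial.eval_mul, hev, Polynomial.eval_zero] at h2
  simp [g, Polynomial.derivative'] at h2
  rw [map_sub, map_mul, eval_C]
  linear_combination -h2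

theorem VanishesOnLine.contactPoly [Infinite K] {f : MvPolynomial (Fin 3) K} {p : K × K × K}
    (hf : VanishesOnLine f p) : VanishesOnLine (contactPoly f) p := by
  intro b
  have h1 := hf.derivative b
  have h2 := hf.derivative.derivative b
  simp only [MvPolynomial.contactPoly, map_add, map_sub, map_mul, map_pow, eval_C, pderiv_mul,
    pderiv_C, zero_mul, zero_add, map_ofNat, pderiv_comm'] at h1 h2 ⊢
  rw [sub_eq_zero] at h1
  rw [h1]
  linear_combination (eval ![p.2.2 - p.2.1 * b, p.1, b] (pderiv 0 f)) ^ 2 * h2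

theorem totalDegree_contactPoly_le (f : MvPolynomial (Fin 3) K) :
    (contactPoly f).totalDegree ≤ 3 * f.totalDegree := by
  have h1 (i : Fin 3) : (pderiv i f).totalDegree ≤ f.totalDegree :=
    (totalDegree_pderiv_le f i).trans (Nat.sub_le _ _)
  have h2 (i j : Fin 3) : (pderiv i (pderiv j f)).totalDegree ≤ f.totalDegree :=
    (totalDegree_pderiv_le _ i).trans ((Nat.sub_le _ _).trans (h1 j))
  have hm (a b c : MvPolynomial (Fin 3) K) (ha : a.totalDegree ≤ f.totalDegree)
      (hb : b.totalDegree ≤ f.totalDegree) (hc : c.totalDegree ≤ f.totalDegree) :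
      (a * b * c).totalDegree ≤ 3 * f.totalDegree := by
    have := totalDegree_mul (a * b) c
    have := totalDegree_mul a b
    omega
  rw [MvPolynomial.contactPoly, sq, sq, mul_assoc 2, mul_assoc 2, two_mul]
  refine (totalDegree_add _ _).trans (max_le ((totalDegree_sub _ _).trans (max_le ?_ ?_)) ?_)
  · exact hm _ _ _ (h1 _) (h1 _) (h2 _ _)
  · exact (totalDegree_add _ _).trans (max_le (hm _ _ _ (h1 _) (h1 _) (h2 _ _))
      (hm _ _ _ (h1 _) (h1 _) (h2 _ _)))
  · exact hm _ _ _ (h1 _) (h1 _) (h2 _ _)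

theorem dvd_of_vanishes_on_tangents [Infinite K] {p : ℕ} [CharP K p]
    {f r : MvPolynomial (Fin 3) K} (hf : Irreducible f) (hdeg : f.totalDegree < p)
    (h0 : f.degreeOf 0 ≠ 0) (hw : ¬ f ∣ pderiv 0 f) (hc : f ∣ contactPoly f) {h : K × K × K}
    (hfh : VanishesOnDualLine f h) (hwh : ¬ VanishesOnDualLine (pderiv 0 f) h)
    (hr : ∀ a b : K, eval ![h.1 * a + h.2.2, a, h.2.1] (pderiv 0 f) ≠ 0 →
      eval ![h.1 * a + h.2.2 - (b - h.2.1) / eval ![h.1 * a + h.2.2, a, h.2.1] (pderiv 0 f) *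
        eval ![h.1 * a + h.2.2, a, h.2.1] (pderiv 2 f), a, b] r = 0) :
    f ∣ r := by
  by_contra hnd
  obtain ⟨c, hc0, -, hcv⟩ := exists_elimination hf h0 hnd
  set u : MvPolynomial (Fin 2) K := aeval ![C h.1 * X 0 + C h.2.2, X 0, C h.2.1] (pderiv 0 f)
  have hu (s : Fin 2 → K) : eval s u = eval ![h.1 * s 0 + h.2.2, s 0, h.2.1] (pderiv 0 f) := by
    simp only [u]
    rw [map_aeval, eval]
    congr 2
    · ext x; simp
    · ext1 i; fin_cases i <;> simp
  have hu0 : u ≠ 0 := by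
    intro hu0
    apply hwh
    intro a
    have := hu ![a, 0]
    simpa [hu0] using this.symm
  have : u * c ≠ 0 := mul_ne_zero hu0 hc0
  apply this
  apply MvPolynomial.funext
  intro s
  rw [map_zero, map_mul, mul_eq_zero, or_iff_not_imp_left, hu]
  intro hne
  have hs : s = ![s 0, s 1] := by ext i; fin_cases i <;> rfl
  set t := (s 1 - h.2.1) / eval ![h.1 * s 0 + h.2.2, s 0, h.2.1] (pderiv 0 f) with ht
  have h1 := eval_tangent_eq_zero hf.prime hdeg hw hc _ (hfh (s 0)) t
  have h2 := hr (s 0) (s 1) hne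
  have h3 : h.2.1 + t * eval ![h.1 * s 0 + h.2.2, s 0, h.2.1] (pderiv 0 f) = s 1 := by
    rw [ht]; field_simp; ring
  have h4 := hcv s (h.1 * s 0 + h.2.2 - t *
    eval ![h.1 * s 0 + h.2.2, s 0, h.2.1] (pderiv 2 f))
  rw [hs] at h4
  apply (congrArg (fun x => eval x c) hs).trans
  apply h4
  · have : eval ![h.1 * s 0 + h.2.2 - t *
      eval ![h.1 * s 0 + h.2.2, s 0, h.2.1] (pderiv 2 f), s 0, h.2.1 + t *
        eval ![h.1 * s 0 + h.2.2, s 0, h.2.1] (pderiv 0 f)] f = 0 := h1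
    rw [h3] at this
    exact this
  · exact h2

end MvPolynomial

/-- The incidence relation `p₃ = m₁ p₁ + m₂ p₂ + m₃`. -/
def IncidentTo {K : Type*} [Field K] (p h : K × K × K) : Prop :=
  p.2.2 = h.1 * p.1 + h.2.1 * p.2.1 + h.2.2

namespace MvPolynomial

variable {K : Type*} [Field K]

theorem incidentTo_of_vanishes [Infinite K] {p : ℕ} [CharP K p]
    {f : MvPolynomial (Fin 3) K} (hf : Irreducible f) (hdeg : f.totalDegree < p)
    (h0 : f.degreeOf 0 ≠ 0) (hw : ¬ f ∣ pderiv 0 f) (hc : f ∣ contactPoly f) {h h' : K × K × K}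
    (hfh : VanishesOnDualLine f h) (hwh : ¬ VanishesOnDualLine (pderiv 0 f) h)
    (hfh' : VanishesOnDualLine f h') (hne : h'.2.1 ≠ h.2.1) {q k : K × K × K}
    (hq : VanishesOnLine f q) (hk : VanishesOnDualLine f k) : IncidentTo q k := by
  have hne' : h'.2.1 - h.2.1 ≠ 0 := sub_ne_zero.2 hne
  set U : MvPolynomial (Fin 3) K := aeval ![C h.1 * X 1 + C h.2.2, X 1, C h.2.1] (pderiv 0 f)
  set V : MvPolynomial (Fin 3) K := aeval ![C h.1 * X 1 + C h.2.2, X 1, C h.2.1] (pderiv 2 f)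
  have hev (g : MvPolynomial (Fin 3) K) (s : Fin 3 → K) :
      eval s (aeval ![C h.1 * X 1 + C h.2.2, X 1, C h.2.1] g : MvPolynomial (Fin 3) K) =
        eval ![h.1 * s 1 + h.2.2, s 1, h.2.1] g := by
    rw [map_aeval, eval]
    congr 2
    · ext x; simp
    · ext1 i; fin_cases i <;> simp
  have hR : f ∣ U * (X 0 - C h.1 * X 1 - C h.2.2) + V * (X 2 - C h.2.1) := by
    refine dvd_of_vanishes_on_tangents hf hdeg h0 hw hc hfh hwh fun a b hab => ?_
    simp only [U, V, map_add, map_mul, map_sub, hev, eval_X, eval_C, Matrix.cons_val]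
    field_simp
    ring
  have hR1 (a : K) : eval ![h.1 * a + h.2.2, a, h.2.1] (pderiv 0 f) *
      (h'.1 * a + h'.2.2 - (h.1 * a + h.2.2)) +
      eval ![h.1 * a + h.2.2, a, h.2.1] (pderiv 2 f) * (h'.2.1 - h.2.1) = 0 := by
    obtain ⟨r, hr⟩ := hR
    have := congrArg (eval ![h'.1 * a + h'.2.2, a, h'.2.1]) hr
    simp only [U, V, map_add, map_mul, map_sub, hev, eval_X, eval_C, Matrix.cons_val, hfh' a,
      zero_mul] at this
    linear_combination this
  have hR2 : f ∣ C (h'.2.1 - h.2.1) * (X 0 - C h.1 * X 1 - C h.2.2) -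
      (C (h'.1 - h.1) * X 1 + C (h'.2.2 - h.2.2)) * (X 2 - C h.2.1) := by
    refine dvd_of_vanishes_on_tangents hf hdeg h0 hw hc hfh hwh fun a b hab => ?_
    simp only [map_add, map_mul, map_sub, eval_X, eval_C, Matrix.cons_val]
    have := hR1 a
    field_simp
    linear_combination (h.2.1 - b) * this
  obtain ⟨r, hr⟩ := hR2
  have e1 := congrArg (eval ![q.2.2 - q.2.1 * k.2.1, q.1, k.2.1]) hr
  have e2 := congrArg (eval ![k.1 * q.1 + k.2.2, q.1, k.2.1]) hr
  simp only [map_add, map_mul, map_sub, eval_X, eval_C, Matrix.cons_val, hq k.2.1, hk q.1,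
    zero_mul] at e1 e2
  have e3 : (h'.2.1 - h.2.1) * (q.2.2 - (k.1 * q.1 + k.2.1 * q.2.1 + k.2.2)) = 0 := by
    linear_combination e1 - e2
  exact sub_eq_zero.1 ((mul_eq_zero.1 e3).resolve_left hne')

end MvPolynomial

section Incidences

open scoped Classical
open MvPolynomial

variable {K : Type*} [Field K]

/-- The number of incidences between `P` and `H`. -/
noncomputable def incidenceCount (P H : Finset (K × K × K)) : ℕ :=
  ∑ h ∈ H, (P.filter fun p => IncidentTo p h).card

theorem incidenceCount_eq_sum_left (P H : Finset (K × K × K)) :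
    incidenceCount P H = ∑ p ∈ P, (H.filter fun h => IncidentTo p h).card := by
  simp only [incidenceCount, Finset.card_filter]
  exact Finset.sum_comm

theorem incidenceCount_mono {P P' H H' : Finset (K × K × K)} (hP : P ⊆ P') (hH : H ⊆ H') :
    incidenceCount P H ≤ incidenceCount P' H' :=
  (Finset.sum_le_sum fun _ _ => Finset.card_le_card (Finset.filter_subset_filter _ hP)).trans
    (Finset.sum_le_sum_of_subset hH)

theorem incidenceCount_filter_add_right (P H : Finset (K × K × K)) (s : K × K × K → Prop)
    [DecidablePred s] :
    incidenceCount P (H.filter s) + incidenceCount P (H.filter fun h => ¬ s h) =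
      incidenceCount P H :=
  Finset.sum_filter_add_sum_filter_not _ _ _

theorem incidenceCount_filter_add_left (P H : Finset (K × K × K)) (s : K × K × K → Prop)
    [DecidablePred s] :
    incidenceCount (P.filter s) H + incidenceCount (P.filter fun h => ¬ s h) H =
      incidenceCount P H := by
  simp only [incidenceCount_eq_sum_left]
  exact Finset.sum_filter_add_sum_filter_not _ _ _

theorem incidenceCount_le_right {P H : Finset (K × K × K)} {n : ℕ}
    (h : ∀ h ∈ H, (P.filter fun p => IncidentTo p h).card ≤ n) :
    incidenceCount P H ≤ n * H.card := by
  rw [mul_comm]; exact Finset.sum_le_card_nsmul _ _ _ h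

theorem incidenceCount_le_left {P H : Finset (K × K × K)} {n : ℕ}
    (h : ∀ p ∈ P, (H.filter fun h => IncidentTo p h).card ≤ n) :
    incidenceCount P H ≤ n * P.card := by
  rw [mul_comm, incidenceCount_eq_sum_left]; exact Finset.sum_le_card_nsmul _ _ _ h

theorem card_filter_incidentTo_le_left {f : MvPolynomial (Fin 3) K} {H : Finset (K × K × K)}
    (hH : Set.InjOn (fun h : K × K × K => h.2.1) H) (hf : ∀ h ∈ H, VanishesOnDualLine f h)
    {p : K × K × K} (hp : ¬ VanishesOnLine f p) :
    (H.filter fun h => IncidentTo p h).card ≤ f.totalDegree := by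
  by_contra! hlt
  apply hp
  apply vanishesOnLine_of_card f p ((H.filter fun h => IncidentTo p h).image fun h => h.2.1)
  · intro b hb
    obtain ⟨h, hh, rfl⟩ := Finset.mem_image.1 hb
    obtain ⟨hh, hi⟩ := Finset.mem_filter.1 hh
    rw [← hf h hh p.1]
    congr 2
    rw [hi]; ring_nf
  · rwa [Finset.card_image_of_injOn (hH.mono (Finset.filter_subset _ _))]

theorem card_filter_incidentTo_le_right {f : MvPolynomial (Fin 3) K} {P : Finset (K × K × K)}
    (hP : Set.InjOn (fun p : K × K × K => p.1) P) (hf : ∀ p ∈ P, VanishesOnLine f p)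
    {h : K × K × K} (hh : ¬ VanishesOnDualLine f h) :
    (P.filter fun p => IncidentTo p h).card ≤ f.totalDegree := by
  by_contra! hlt
  apply hh
  apply vanishesOnDualLine_of_card f h ((P.filter fun p => IncidentTo p h).image fun p => p.1)
  · intro b hb
    obtain ⟨p, hp, rfl⟩ := Finset.mem_image.1 hb
    obtain ⟨hp, hi⟩ := Finset.mem_filter.1 hp
    rw [← hf p hp h.2.1]
    congr 2
    rw [hi]; ring_nf
  · rwa [Finset.card_image_of_injOn (hP.mono (Finset.filter_subset _ _))]

theorem incidentTo_of_rich [Infinite K] {p : ℕ} [CharP K p] {f : MvPolynomial (Fin 3) K}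
    (hf : Irreducible f) (hdeg : f.totalDegree < p) {Q H : Finset (K × K × K)}
    (hQ : Set.InjOn (fun p : K × K × K => p.1) Q) (hH : Set.InjOn (fun h : K × K × K => h.2.1) H)
    (hQf : ∀ q ∈ Q, VanishesOnLine f q) (hHf : ∀ h ∈ H, VanishesOnDualLine f h)
    (hrich : ∀ h ∈ H, 3 * f.totalDegree < (Q.filter fun q => IncidentTo q h).card)
    (hcard : 6 * f.totalDegree ^ 2 < H.card) {q h : K × K × K} (hq : q ∈ Q) (hh : h ∈ H) :
    IncidentTo q h := by
  have h0 : f.degreeOf 0 ≠ 0 := by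
    intro h0
    have := card_le_of_vanishesOnDualLine_of_degreeOf_eq_zero hf.ne_zero h0 H hH hHf
    nlinarith
  have hpos : 0 < f.totalDegree := lt_of_lt_of_le (Nat.pos_of_ne_zero h0)
    (degreeOf_le_totalDegree _ _)
  have hw0 : pderiv 0 f ≠ 0 := fun h => h0 (degreeOf_eq_zero_of_pderiv_eq_zero f 0 hdeg h)
  have hdw := totalDegree_pderiv_le f 0
  have hw : ¬ f ∣ pderiv 0 f := fun h => by
    have := totalDegree_le_of_dvd_of_isDomain h hw0
    omega
  have hc : f ∣ contactPoly f := by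
    by_contra hc
    have := card_le_of_vanishesOnDualLine hf h0 hc H hH hHf fun h hh => by
      by_contra hcon
      have h1 := card_filter_incidentTo_le_right hQ (fun q hq => (hQf q hq).contactPoly) hcon
      exact absurd (hrich h hh) (not_lt.2 (h1.trans (totalDegree_contactPoly_le f)))
    have h2 := totalDegree_contactPoly_le f
    have : 2 * f.totalDegree * (contactPoly f).totalDegree ≤
      2 * f.totalDegree * (3 * f.totalDegree) := by gcongr
    nlinarith
  obtain ⟨h₀, hh₀, hwh⟩ : ∃ h ∈ H, ¬ VanishesOnDualLine (pderiv 0 f) h := by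
    by_contra! hcon
    have := card_le_of_vanishesOnDualLine hf h0 hw H hH hHf hcon
    have : 2 * f.totalDegree * (pderiv 0 f).totalDegree ≤
      2 * f.totalDegree * f.totalDegree := by gcongr; omega
    nlinarith
  obtain ⟨h₁, hh₁, hne⟩ := Finset.exists_mem_ne (by nlinarith : 1 < H.card) h₀
  exact incidentTo_of_vanishes hf hdeg h0 hw hc (hHf _ hh₀) hwh (hHf _ hh₁)
    (fun h => hne (hH hh₁ hh₀ h)) (hQf _ hq) (hHf _ hh)

theorem incidenceCount_le_of_irreducible [Infinite K] {p : ℕ} [CharP K p]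
    {f : MvPolynomial (Fin 3) K} (hf : Irreducible f) (hdeg : f.totalDegree < p) {m : ℕ}
    {P H : Finset (K × K × K)} (hP : Set.InjOn (fun p : K × K × K => p.1) P)
    (hH : Set.InjOn (fun h : K × K × K => h.2.1) H) (hHf : ∀ h ∈ H, VanishesOnDualLine f h)
    (hm : ∀ h ∈ H, ∀ h' ∈ H, h ≠ h' →
      (P.filter fun p => IncidentTo p h ∧ IncidentTo p h').card ≤ m) :
    ∃ H' ⊆ H, H'.card ≤ 6 * f.totalDegree ^ 2 ∧ incidenceCount P H ≤ incidenceCount P H' +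
      f.totalDegree * P.card + (3 * f.totalDegree + m) * H.card := by
  set Q := P.filter fun q => VanishesOnLine f q with hQdef
  set R := H.filter fun h => 3 * f.totalDegree < (Q.filter fun q => IncidentTo q h).card with hRdef
  have hQP : Q ⊆ P := Finset.filter_subset _ _
  have hRH : R ⊆ H := Finset.filter_subset _ _
  have e1 := incidenceCount_filter_add_left P H fun q => VanishesOnLine f q
  have e2 := incidenceCount_filter_add_right Q H fun h =>
    3 * f.totalDegree < (Q.filter fun q => IncidentTo q h).card
  rw [← hQdef] at e1
  rw [← hRdef] at e2
  have b1 : incidenceCount (P.filter fun q => ¬ VanishesOnLine f q) H ≤ f.totalDegree * P.card :=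
    (incidenceCount_le_left fun q hq =>
      card_filter_incidentTo_le_left hH hHf (Finset.mem_filter.1 hq).2).trans
      (Nat.mul_le_mul_left _ (Finset.card_filter_le _ _))
  have b2 : incidenceCount Q (H.filter fun h => ¬ 3 * f.totalDegree <
      (Q.filter fun q => IncidentTo q h).card) ≤ 3 * f.totalDegree * H.card :=
    (incidenceCount_le_right fun h hh => not_lt.1 (Finset.mem_filter.1 hh).2).trans
      (Nat.mul_le_mul_left _ (Finset.card_filter_le _ _))
  rcases le_or_gt R.card (6 * f.totalDegree ^ 2) with hR | hR
  · refine ⟨R, hRH, hR, ?_⟩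
    have := incidenceCount_mono hQP (Finset.Subset.refl R)
    rw [add_mul]
    omega
  · refine ⟨∅, Finset.empty_subset _, by simp, ?_⟩
    have hinc {q h : K × K × K} (hq : q ∈ Q) (hh : h ∈ R) : IncidentTo q h :=
      incidentTo_of_rich hf hdeg (hP.mono hQP) (hH.mono hRH)
        (fun q hq => (Finset.mem_filter.1 hq).2) (fun h hh => hHf h (hRH hh))
        (fun h hh => (Finset.mem_filter.1 hh).2) hR hq hh
    have b3 : incidenceCount Q R ≤ m * H.card := by
      refine (incidenceCount_le_right fun h hh => ?_).trans
        (Nat.mul_le_mul_left _ (Finset.card_le_card hRH))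
      rcases le_or_gt R.card 1 with h1 | h1
      · have h2 := Finset.card_pos.2 ⟨h, hh⟩
        have h3 : f.totalDegree = 0 := by nlinarith
        obtain ⟨c, hc⟩ : ∃ c, f = C c := ⟨_, totalDegree_eq_zero_iff_eq_C.1 h3⟩
        exfalso
        apply hf.not_isUnit
        rw [hc]
        refine (isUnit_iff_ne_zero.2 ?_).map _
        rintro rfl
        exact hf.ne_zero (by simp [hc])
      · obtain ⟨h', hh', hne⟩ := Finset.exists_mem_ne h1 h
        refine (Finset.card_le_card fun q hq => ?_).trans (hm h (hRH hh) h' (hRH hh') hne.symm)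
        have hq := (Finset.mem_filter.1 hq).1
        exact Finset.mem_filter.2 ⟨hQP hq, hinc hq hh, hinc hq hh'⟩
    rw [add_mul]
    omega

theorem vanishesOnDualLine_mul [Infinite K] {f g : MvPolynomial (Fin 3) K} {h : K × K × K}
    (hfg : VanishesOnDualLine (f * g) h) : VanishesOnDualLine f h ∨ VanishesOnDualLine g h := by
  set s : Fin 3 → Polynomial K := ![Polynomial.C h.1 * Polynomial.X + Polynomial.C h.2.2,
    Polynomial.X, Polynomial.C h.2.1]
  have hev (k : MvPolynomial (Fin 3) K) (a : K) :
      (aeval s k).eval a = eval ![h.1 * a + h.2.2, a, h.2.1] k := by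
    rw [aeval_def, polynomial_eval_eval₂, eval, coe_eval₂Hom]
    congr 1
    · ext x; simp
    · ext1 i; fin_cases i <;> simp [s]
  have h0 : aeval s f * aeval s g = 0 := by
    rw [← map_mul]
    exact Polynomial.funext fun b => by rw [hev, hfg b, Polynomial.eval_zero]
  rcases mul_eq_zero.1 h0 with h | h
  · exact Or.inl fun a => by rw [← hev, h, Polynomial.eval_zero]
  · exact Or.inr fun a => by rw [← hev, h, Polynomial.eval_zero]

theorem incidenceCount_le_of_vanishes [Infinite K] {p : ℕ} [CharP K p] {m : ℕ}
    {P : Finset (K × K × K)} (hP : Set.InjOn (fun p : K × K × K => p.1) P)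
    (f : MvPolynomial (Fin 3) K) (hf : f ≠ 0) (hdeg : f.totalDegree < p) :
    ∀ H : Finset (K × K × K),
    Set.InjOn (fun h : K × K × K => h.2.1) H → (∀ h ∈ H, VanishesOnDualLine f h) →
    (∀ h ∈ H, ∀ h' ∈ H, h ≠ h' →
      (P.filter fun p => IncidentTo p h ∧ IncidentTo p h').card ≤ m) →
    ∃ H' ⊆ H, H'.card ≤ 6 * f.totalDegree ^ 2 ∧ incidenceCount P H ≤ incidenceCount P H' +
      f.totalDegree * P.card + (3 * f.totalDegree + m) * H.card := by
  induction f using WfDvdMonoid.induction_on_irreducible with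
  | zero => exact absurd rfl hf
  | unit u hu =>
    intro H _ hHf _
    have : H = ∅ := by
      refine Finset.eq_empty_of_forall_notMem fun h hh => ?_
      have := (hu.map (eval ![h.1 * 0 + h.2.2, 0, h.2.1])).ne_zero
      exact this (hHf h hh 0)
    exact ⟨∅, by simp, by simp, by simp [this, incidenceCount]⟩
  | mul a i ha hi ih =>
    intro H hH hHf hm
    rw [totalDegree_mul_of_isDomain hi.ne_zero ha] at hdeg ⊢
    set H₁ := H.filter fun h => VanishesOnDualLine i h with hH₁
    set H₂ := H.filter fun h => ¬ VanishesOnDualLine i h with hH₂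
    have s1 : H₁ ⊆ H := Finset.filter_subset _ _
    have s2 : H₂ ⊆ H := Finset.filter_subset _ _
    obtain ⟨A, hA, hA1, hA2⟩ := incidenceCount_le_of_irreducible hi (by omega) hP (hH.mono s1)
      (fun h hh => (Finset.mem_filter.1 hh).2) (fun h hh h' hh' => hm h (s1 hh) h' (s1 hh'))
    obtain ⟨B, hB, hB1, hB2⟩ := ih ha (by omega) H₂ (hH.mono s2)
      (fun h hh => (vanishesOnDualLine_mul (hHf h (s2 hh))).resolve_left (Finset.mem_filter.1 hh).2)
      (fun h hh h' hh' => hm h (s2 hh) h' (s2 hh'))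
    have hd : Disjoint A B := (Finset.disjoint_filter_filter_not H H _).mono hA hB
    refine ⟨A ∪ B, Finset.union_subset (hA.trans s1) (hB.trans s2), ?_, ?_⟩
    · rw [Finset.card_union_of_disjoint hd]
      nlinarith
    · have e1 : incidenceCount P (A ∪ B) = incidenceCount P A + incidenceCount P B :=
        Finset.sum_union hd
      have e2 := incidenceCount_filter_add_right P H fun h => VanishesOnDualLine i h
      have e3 := Finset.card_filter_add_card_filter_not (s := H)
        (fun h => VanishesOnDualLine i h)
      rw [← hH₁, ← hH₂] at e2 e3
      rw [e1, ← e2, ← e3]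
      nlinarith [Nat.zero_le (i.totalDegree * H₂.card), Nat.zero_le (a.totalDegree * H₁.card)]

end Incidences

namespace MvPolynomial

theorem exists_vanishesOnDualLine {K : Type*} [Field K] [Infinite K] (H : Finset (K × K × K)) :
    ∃ f : MvPolynomial (Fin 3) K, f ≠ 0 ∧ f.totalDegree ≤ 3 * Nat.sqrt (3 * H.card) ∧
      ∀ h ∈ H, VanishesOnDualLine f h := by
  classical
  set D := Nat.sqrt (3 * H.card) with hD
  have hlt : 3 * H.card < (D + 1) * (D + 1) := Nat.lt_succ_sqrt _
  let ex (e : Fin 3 → Fin (D + 1)) : Fin 3 →₀ ℕ := Finsupp.equivFunOnFinite.symm fun i => (e i : ℕ)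
  have hex : Function.Injective ex := by
    intro e e' h
    funext i
    exact Fin.ext (DFunLike.congr_fun h i)
  let Φ : ((Fin 3 → Fin (D + 1)) → K) →ₗ[K] MvPolynomial (Fin 3) K :=
    Fintype.linearCombination K fun e => monomial (ex e) (1 : K)
  have hΦ (c) : Φ c = ∑ e, monomial (ex e) (c e) := by
    simp [Φ, Fintype.linearCombination_apply, smul_monomial]
  let pt (h : K × K × K) (a : K) : Fin 3 → K := ![h.1 * a + h.2.2, a, h.2.1]
  let L : ((Fin 3 → Fin (D + 1)) → K) →ₗ[K] (H × Fin (3 * D + 1) → K) :=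
    LinearMap.pi fun x => (aeval (pt x.1 (Infinite.natEmbedding K x.2))).toLinearMap.comp Φ
  have hker : L.ker ≠ ⊥ := by
    apply LinearMap.ker_ne_bot_of_finrank_lt
    simp only [Module.finrank_fintype_fun_eq_card, Fintype.card_prod, Fintype.card_pi_const,
      Fintype.card_fin, Fintype.card_coe]
    nlinarith
  obtain ⟨c, hc, hc0⟩ := Submodule.exists_mem_ne_zero_of_ne_bot hker
  have hdeg : (Φ c).totalDegree ≤ 3 * D := by
    rw [hΦ]
    refine totalDegree_finsetSum_le fun e _ => ?_
    refine (totalDegree_monomial_le _ _).trans ?_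
    rw [Finsupp.sum_fintype _ _ (fun _ => rfl), Fin.sum_univ_three]
    have he (i : Fin 3) : ex e i ≤ D := Nat.le_of_lt_succ (e i).2
    have h0 := he 0
    have h1 := he 1
    have h2 := he 2
    simp only [id]
    omega
  refine ⟨Φ c, ?_, hdeg, ?_⟩
  · intro h0
    apply hc0
    funext e
    have := congrArg (coeff (ex e)) h0
    rw [hΦ, coeff_sum, Finset.sum_eq_single e] at this
    · simpa using this
    · intro e' _ hne
      rw [coeff_monomial, if_neg fun h => hne (hex h)]
    · simp
  · intro h hh
    apply vanishesOnDualLine_of_card (Φ c) h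
      ((Finset.range (3 * D + 1)).image (Infinite.natEmbedding K))
    · intro a ha
      obtain ⟨j, hj, rfl⟩ := Finset.mem_image.1 ha
      exact congrFun (LinearMap.mem_ker.1 hc) (⟨h, hh⟩, ⟨j, Finset.mem_range.1 hj⟩)
    · rw [Finset.card_image_of_injective _ (Infinite.natEmbedding K).injective, Finset.card_range]
      omega

end MvPolynomial

section Sampling

variable {β : Type*}

/-- The expectation of `F` at a random subset of `H` containing each element of `H`
independently with probability `q`. -/
noncomputable def subsetAverage (q : ℝ) (H : Finset β) (F : Finset β → ℝ) : ℝ :=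
  ∑ T ∈ H.powerset, q ^ T.card * (1 - q) ^ (H.card - T.card) * F T

theorem subsetAverage_add (q : ℝ) (H : Finset β) (F G : Finset β → ℝ) :
    subsetAverage q H (fun T => F T + G T) = subsetAverage q H F + subsetAverage q H G := by
  simp only [subsetAverage, mul_add, Finset.sum_add_distrib]

theorem subsetAverage_mul (q c : ℝ) (H : Finset β) (F : Finset β → ℝ) :
    subsetAverage q H (fun T => c * F T) = c * subsetAverage q H F := by
  rw [subsetAverage, subsetAverage, Finset.mul_sum]
  exact Finset.sum_congr rfl fun T _ => by ring

theorem subsetAverage_sum {α : Type*} (q : ℝ) (H : Finset β) (P : Finset α)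
    (F : α → Finset β → ℝ) :
    subsetAverage q H (fun T => ∑ p ∈ P, F p T) = ∑ p ∈ P, subsetAverage q H (F p) := by
  simp only [subsetAverage, Finset.mul_sum]
  exact Finset.sum_comm

variable [DecidableEq β]

theorem subsetAverage_insert (q : ℝ) {H : Finset β} {a : β} (ha : a ∉ H) (F : Finset β → ℝ) :
    subsetAverage q (insert a H) F =
      q * subsetAverage q H (fun T => F (insert a T)) + (1 - q) * subsetAverage q H F := by
  rw [subsetAverage, Finset.sum_powerset_insert ha, add_comm, subsetAverage, subsetAverage,
    Finset.mul_sum, Finset.mul_sum]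
  congr 1
  · refine Finset.sum_congr rfl fun T hT => ?_
    have hT := Finset.mem_powerset.1 hT
    rw [Finset.card_insert_of_notMem fun h => ha (hT h), Finset.card_insert_of_notMem ha,
      Nat.add_sub_add_right]
    ring
  · refine Finset.sum_congr rfl fun T hT => ?_
    have hT := Finset.card_le_card (Finset.mem_powerset.1 hT)
    rw [Finset.card_insert_of_notMem ha, Nat.sub_add_comm hT]
    ring

theorem subsetAverage_const (q : ℝ) (H : Finset β) (c : ℝ) :
    subsetAverage q H (fun _ => c) = c := by
  induction H using Finset.induction_on with
  | empty => simp [subsetAverage]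
  | insert a H ha ih => rw [subsetAverage_insert q ha, ih]; ring

theorem subsetAverage_card_inter_sub (q : ℝ) (H S : Finset β) :
    subsetAverage q H (fun T => ((T ∩ S).card : ℝ) - q * (H ∩ S).card) = 0 ∧
    subsetAverage q H (fun T => (((T ∩ S).card : ℝ) - q * (H ∩ S).card) ^ 2) =
      q * (1 - q) * (H ∩ S).card := by
  induction H using Finset.induction_on with
  | empty => simp [subsetAverage]
  | insert a H ha ih =>
    obtain ⟨ih1, ih2⟩ := ih
    rw [subsetAverage_insert q ha, subsetAverage_insert q ha]
    by_cases haS : a ∈ S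
    · have hc : ((insert a H) ∩ S).card = (H ∩ S).card + 1 := by
        rw [Finset.insert_inter_of_mem haS, Finset.card_insert_of_notMem (by simp [ha])]
      have h1 (c : ℝ) : subsetAverage q H (fun T => ((T ∩ S).card : ℝ) - q * (H ∩ S).card + c)
          = c := by
        rw [subsetAverage_add, ih1, subsetAverage_const, zero_add]
      have h2 (c : ℝ) : subsetAverage q H
          (fun T => (((T ∩ S).card : ℝ) - q * (H ∩ S).card + c) ^ 2) =
            q * (1 - q) * (H ∩ S).card + c ^ 2 := by
        have e : (fun T : Finset β => (((T ∩ S).card : ℝ) - q * (H ∩ S).card + c) ^ 2) = fun T =>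
            (((T ∩ S).card : ℝ) - q * (H ∩ S).card) ^ 2 +
              (2 * c) * (((T ∩ S).card : ℝ) - q * (H ∩ S).card) + c ^ 2 := by
          funext T; ring
        rw [e, subsetAverage_add, subsetAverage_add, subsetAverage_const, subsetAverage_mul, ih1,
          ih2]
        ring
      have e1 (G : ℝ → ℝ) : subsetAverage q H (fun T => G (((insert a T ∩ S).card : ℝ) -
          q * (((insert a H) ∩ S).card : ℕ))) = subsetAverage q H (fun T =>
            G (((T ∩ S).card : ℝ) - q * (H ∩ S).card + (1 - q))) := by
        refine Finset.sum_congr rfl fun T hT => ?_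
        have hT := Finset.mem_powerset.1 hT
        beta_reduce
        rw [hc, Finset.insert_inter_of_mem haS, Finset.card_insert_of_notMem
          fun h => ha (hT (Finset.mem_inter.1 h).1)]
        push_cast
        ring_nf
      have e2 (G : ℝ → ℝ) : subsetAverage q H (fun T => G (((T ∩ S).card : ℝ) -
          q * (((insert a H) ∩ S).card : ℕ))) = subsetAverage q H (fun T =>
            G (((T ∩ S).card : ℝ) - q * (H ∩ S).card + (-q))) := by
        refine Finset.sum_congr rfl fun T hT => ?_
        beta_reduce
        rw [hc]
        push_cast
        ring_nf
      rw [e1 fun x => x, e2 fun x => x, e1 fun x => x ^ 2, e2 fun x => x ^ 2, h1, h1, h2, h2, hc]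
      push_cast
      constructor <;> ring
    · simp only [Finset.insert_inter_of_notMem haS, ih1, ih2]
      constructor <;> ring

theorem exists_le_of_subsetAverage_le {q : ℝ} (hq0 : 0 < q) (hq1 : q < 1) (H : Finset β)
    {F : Finset β → ℝ} {c : ℝ} (h : subsetAverage q H F ≤ c) : ∃ T ⊆ H, F T ≤ c := by
  rw [← subsetAverage_const q H c] at h
  obtain ⟨T, hT, hle⟩ := Finset.exists_le_of_sum_le (Finset.powerset_nonempty H) h
  have : 0 < 1 - q := by linarith
  exact ⟨T, Finset.mem_powerset.1 hT, le_of_mul_le_mul_left hle (by positivity)⟩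

theorem exists_sample {α : Type*} (P : Finset α) (H : Finset β) (S : α → Finset β)
    (hS : ∀ p ∈ P, S p ⊆ H) {m : ℕ} (hm : 2 ≤ m) :
    ∃ T ⊆ H, m * T.card ≤ 2 * H.card ∧
      ∑ p ∈ P with 2 * m * (T ∩ S p).card < (S p).card, (S p).card ≤ 8 * m * P.card := by
  rcases H.eq_empty_or_nonempty with rfl | hH
  · refine ⟨∅, by simp, by simp, ?_⟩
    rw [Finset.sum_eq_zero]
    · simp
    · intro p hp
      rw [Finset.card_eq_zero, ← Finset.subset_empty]
      exact hS p (Finset.mem_filter.1 hp).1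
  rcases P.eq_empty_or_nonempty with rfl | hP
  · exact ⟨∅, by simp, by simp, by simp⟩
  have hm0 : (0 : ℝ) < m := by positivity
  have hm1 : (1 : ℝ) < m := by exact_mod_cast hm
  have hHpos : (0 : ℝ) < H.card := by exact_mod_cast hH.card_pos
  have hPpos : (0 : ℝ) < P.card := by exact_mod_cast hP.card_pos
  set q : ℝ := 1 / m with hq
  have hq0 : 0 < q := by positivity
  have hq1 : q < 1 := by rw [hq, div_lt_one hm0]; exact hm1
  have hmq : m * q = 1 := by rw [hq]; field_simp
  let B (p : α) (T : Finset β) : ℝ := (((T ∩ S p).card : ℝ) - q * (H ∩ S p).card) ^ 2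
  have hB (p) (hp : p ∈ P) : subsetAverage q H (B p) = q * (1 - q) * (S p).card := by
    have := (subsetAverage_card_inter_sub q H (S p)).2
    simp only [B]
    rwa [Finset.inter_eq_right.2 (hS p hp)] at this ⊢
  have hcard : subsetAverage q H (fun T => (T.card : ℝ)) = q * H.card := by
    have h1 := (subsetAverage_card_inter_sub q H H).1
    simp only [sub_eq_add_neg] at h1
    rw [subsetAverage_add, subsetAverage_const, Finset.inter_self] at h1
    have h2 : subsetAverage q H (fun T => (T.card : ℝ)) =
        subsetAverage q H (fun T => ((T ∩ H).card : ℝ)) := by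
      refine Finset.sum_congr rfl fun T hT => ?_
      beta_reduce
      rw [Finset.inter_eq_left.2 (Finset.mem_powerset.1 hT)]
    linarith
  obtain ⟨T, hTH, hT⟩ := exists_le_of_subsetAverage_le hq0 hq1 H
    (F := fun T => 4 * m * P.card * m * T.card + H.card * ∑ p ∈ P, 4 * m ^ 2 / (S p).card * B p T)
    (c := 8 * m * P.card * H.card) (by
      rw [subsetAverage_add, subsetAverage_mul, subsetAverage_mul, subsetAverage_sum, hcard]
      simp only [subsetAverage_mul]
      have h1 : ∑ p ∈ P, 4 * (m : ℝ) ^ 2 / (S p).card * subsetAverage q H (B p) ≤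
          ∑ p ∈ P, 4 * (m : ℝ) := by
        refine Finset.sum_le_sum fun p hp => ?_
        rw [hB p hp]
        rcases Nat.eq_zero_or_pos (S p).card with h0 | h0
        · simp [h0]
        · have : (0 : ℝ) < (S p).card := by exact_mod_cast h0
          have e : 4 * (m : ℝ) ^ 2 / (S p).card * (q * (1 - q) * (S p).card) =
            4 * m * (m * q) * (1 - q) := by field_simp
          rw [e, hmq]
          nlinarith
      rw [Finset.sum_const, nsmul_eq_mul] at h1
      have h2 := mul_le_mul_of_nonneg_left h1 hHpos.le
      have h3 : 4 * (m : ℝ) * P.card * m * (q * H.card) = 4 * m * P.card * H.card * (m * q) := by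
        ring
      rw [h3, hmq]
      linarith)
  have hsum0 : 0 ≤ ∑ p ∈ P, 4 * (m : ℝ) ^ 2 / (S p).card * B p T :=
    Finset.sum_nonneg fun p _ => by positivity
  refine ⟨T, hTH, ?_, ?_⟩
  · have h1 : 4 * (m : ℝ) * P.card * (m * T.card) ≤ 4 * m * P.card * (2 * H.card) := by
      have := mul_nonneg hHpos.le hsum0
      linarith
    have := le_of_mul_le_mul_left h1 (by positivity)
    exact_mod_cast this
  · have h1 : (H.card : ℝ) * ∑ p ∈ P, 4 * (m : ℝ) ^ 2 / (S p).card * B p T ≤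
        H.card * (8 * m * P.card) := by
      have : 0 ≤ 4 * (m : ℝ) * P.card * m * T.card := by positivity
      linarith
    have h2 := le_of_mul_le_mul_left h1 hHpos
    have h3 : (∑ p ∈ P with 2 * m * (T ∩ S p).card < (S p).card, ((S p).card : ℝ)) ≤
        ∑ p ∈ P with 2 * m * (T ∩ S p).card < (S p).card,
          4 * (m : ℝ) ^ 2 / (S p).card * B p T := by
      refine Finset.sum_le_sum fun p hp => ?_
      obtain ⟨hp, hlt⟩ := Finset.mem_filter.1 hp
      have h0 : (0 : ℝ) < (S p).card := by exact_mod_cast lt_of_le_of_lt (Nat.zero_le _) hlt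
      have hlt : 2 * (m : ℝ) * (T ∩ S p).card < (S p).card := by exact_mod_cast hlt
      simp only [B]
      rw [Finset.inter_eq_right.2 (hS p hp), div_mul_eq_mul_div, le_div_iff₀ h0]
      have e : 4 * (m : ℝ) ^ 2 * (((T ∩ S p).card : ℝ) - q * (S p).card) ^ 2 =
          (2 * ((m * q) * (S p).card) - 2 * m * (T ∩ S p).card) ^ 2 := by ring
      rw [e, hmq]
      nlinarith
    have h4 : (∑ p ∈ P with 2 * m * (T ∩ S p).card < (S p).card,
          4 * (m : ℝ) ^ 2 / (S p).card * B p T) ≤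
        ∑ p ∈ P, 4 * (m : ℝ) ^ 2 / (S p).card * B p T :=
      Finset.sum_le_sum_of_subset_of_nonneg (Finset.filter_subset _ _)
        fun p _ _ => by positivity
    have := (h3.trans h4).trans h2
    exact_mod_cast this

end Sampling

section IncidenceBound

open scoped Classical
open MvPolynomial

variable {K : Type*} [Field K] [Infinite K] {p : ℕ} [CharP K p]

theorem incidenceCount_le_step {r m : ℕ} (hr : 1296 ≤ r) {P H : Finset (K × K × K)}
    (hP : Set.InjOn (fun p : K × K × K => p.1) P) (hH : Set.InjOn (fun h : K × K × K => h.2.1) H)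
    (hm : ∀ h ∈ H, ∀ h' ∈ H, h ≠ h' →
      (P.filter fun p => IncidentTo p h ∧ IncidentTo p h').card ≤ m)
    (hp : 54 * H.card < r * p ^ 2) :
    ∃ H' ⊆ H, ∃ d : ℕ, 4 * H'.card ≤ H.card ∧ d ^ 2 ≤ H.card ∧
      incidenceCount P H ≤ incidenceCount P H' + (8 * r + 2 * r * d + d) * P.card +
        (4 * d + m) * H.card := by
  obtain ⟨T, hTH, hTcard, hTbad⟩ := exists_sample P H (fun p => H.filter fun h => IncidentTo p h)
    (fun p _ => Finset.filter_subset _ _) (by omega : 2 ≤ r)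
  obtain ⟨f, hf0, hfd, hfT⟩ := exists_vanishesOnDualLine T
  set d := f.totalDegree with hd
  have hs : Nat.sqrt (3 * T.card) * Nat.sqrt (3 * T.card) ≤ 3 * T.card := Nat.sqrt_le _
  have hd2 : d ^ 2 ≤ 27 * T.card := by nlinarith
  have hrd : r * d ^ 2 ≤ 54 * H.card := by nlinarith
  have hdp : d < p := by
    have : r * d ^ 2 < r * p ^ 2 := hrd.trans_lt hp
    exact lt_of_pow_lt_pow_left₀ 2 (Nat.zero_le _) (lt_of_mul_lt_mul_left this (Nat.zero_le _))
  have h24 : 24 * d ^ 2 ≤ H.card := by nlinarith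
  set PZ := P.filter fun q => VanishesOnLine f q with hPZ
  set PN := P.filter fun q => ¬ VanishesOnLine f q with hPN
  set HZ := H.filter fun h => VanishesOnDualLine f h with hHZ
  set HN := H.filter fun h => ¬ VanishesOnDualLine f h with hHN
  have e1 : incidenceCount PZ H + incidenceCount PN H = incidenceCount P H :=
    incidenceCount_filter_add_left P H _
  have e2 : incidenceCount PZ HZ + incidenceCount PZ HN = incidenceCount PZ H :=
    incidenceCount_filter_add_right PZ H _
  have sPZ : PZ ⊆ P := Finset.filter_subset _ _
  have sHZ : HZ ⊆ H := Finset.filter_subset _ _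
  have sHN : HN ⊆ H := Finset.filter_subset _ _
  obtain ⟨H', hH', hcard, hle⟩ := incidenceCount_le_of_vanishes (hP.mono sPZ) f hf0 hdp HZ
    (hH.mono sHZ) (fun h hh => (Finset.mem_filter.1 hh).2) (m := m)
    (fun h hh h' hh' hne => (Finset.card_le_card (Finset.filter_subset_filter _ sPZ)).trans
      (hm h (sHZ hh) h' (sHZ hh') hne))
  have b1 : incidenceCount PZ HN ≤ d * H.card :=
    (incidenceCount_le_right fun h hh => card_filter_incidentTo_le_right (hP.mono sPZ)
      (fun q hq => (Finset.mem_filter.1 hq).2) (Finset.mem_filter.1 hh).2).trans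
      (Nat.mul_le_mul_left _ (Finset.card_le_card sHN))
  have b2 : incidenceCount PN H ≤ 8 * r * P.card + 2 * r * d * P.card := by
    rw [incidenceCount_eq_sum_left,
      ← Finset.sum_filter_add_sum_filter_not PN fun q =>
        2 * r * (T ∩ H.filter fun h => IncidentTo q h).card <
          (H.filter fun h => IncidentTo q h).card]
    refine add_le_add ((Finset.sum_le_sum_of_subset ?_).trans hTbad) ?_
    · exact Finset.filter_subset_filter _ (Finset.filter_subset _ _)
    · rw [mul_comm _ P.card]
      refine (Finset.sum_le_card_nsmul _ _ (2 * r * d) fun q hq => ?_).trans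
        (Nat.mul_le_mul_right _ (Finset.card_le_card
          ((Finset.filter_subset _ _).trans (Finset.filter_subset _ _))))
      obtain ⟨hq, hgood⟩ := Finset.mem_filter.1 hq
      refine (not_lt.1 hgood).trans (Nat.mul_le_mul_left _ ?_)
      have h1 : T ∩ H.filter (fun h => IncidentTo q h) = T.filter fun h => IncidentTo q h := by
        ext x
        simp only [Finset.mem_inter, Finset.mem_filter]
        exact ⟨fun h => ⟨h.1, h.2.2⟩, fun h => ⟨h.1, hTH h.1, h.2⟩⟩
      rw [h1]
      exact card_filter_incidentTo_le_left (hH.mono hTH) hfT (Finset.mem_filter.1 hq).2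
  refine ⟨H', hH'.trans sHZ, d, by nlinarith, by nlinarith, ?_⟩
  have b3 := incidenceCount_mono sPZ (Finset.Subset.refl H')
  have b4 : d * PZ.card ≤ d * P.card := Nat.mul_le_mul_left _ (Finset.card_le_card sPZ)
  have b5 : (3 * d + m) * HZ.card ≤ (3 * d + m) * H.card :=
    Nat.mul_le_mul_left _ (Finset.card_le_card sHZ)
  nlinarith

theorem incidenceCount_le {r m : ℕ} (hr : 1296 ≤ r) {P : Finset (K × K × K)}
    (hP : Set.InjOn (fun p : K × K × K => p.1) P) (H : Finset (K × K × K))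
    (hH : Set.InjOn (fun h : K × K × K => h.2.1) H)
    (hm : ∀ h ∈ H, ∀ h' ∈ H, h ≠ h' →
      (P.filter fun p => IncidentTo p h ∧ IncidentTo p h').card ≤ m)
    (hp : 54 * H.card < r * p ^ 2) :
    (incidenceCount P H : ℝ) ≤ 22 * r * (P.card * √H.card + H.card * √H.card + m * H.card) := by
  induction H using Finset.strongInduction with
  | H H ih =>
    rcases H.eq_empty_or_nonempty with rfl | hne
    · simp [incidenceCount]
    obtain ⟨H', hH', d, h4, hd, hle⟩ := incidenceCount_le_step hr hP hH hm hp
    have hpos := hne.card_pos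
    have hss : H' ⊂ H := by
      refine hH'.ssubset_of_ne ?_
      rintro rfl
      omega
    have ih' := ih H' hss (hH.mono hH') (fun h hh h' hh' => hm h (hH' hh) h' (hH' hh'))
      (by omega)
    have hle' : (incidenceCount P H : ℝ) ≤ incidenceCount P H' + (8 * r + 2 * r * d + d) * P.card +
        (4 * d + m) * H.card := by exact_mod_cast hle
    have h4' : 4 * (H'.card : ℝ) ≤ H.card := by exact_mod_cast h4
    have hpos' : (1 : ℝ) ≤ H.card := by exact_mod_cast hpos
    have hs1 : 1 ≤ √(H.card : ℝ) := Real.one_le_sqrt.2 hpos'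
    have hsd : (d : ℝ) ≤ √(H.card : ℝ) := Real.le_sqrt_of_sq_le (by exact_mod_cast hd)
    have hs2 : √(H'.card : ℝ) ≤ √(H.card : ℝ) / 2 := by
      rw [Real.sqrt_le_left (by positivity), div_pow, Real.sq_sqrt (by positivity)]
      linarith
    have hr' : (1296 : ℝ) ≤ r := by exact_mod_cast hr
    set s := √(H.card : ℝ)
    set M : ℝ := (H.card : ℝ)
    set L : ℝ := (P.card : ℝ)
    have hL : 0 ≤ L := Nat.cast_nonneg _
    have hm0 : (0 : ℝ) ≤ m := Nat.cast_nonneg _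
    have c1 : L * √(H'.card : ℝ) ≤ L * (s / 2) := by gcongr
    have c2 : (H'.card : ℝ) * √(H'.card : ℝ) ≤ (M / 4) * (s / 2) := by gcongr; linarith
    have c3 : (m : ℝ) * H'.card ≤ m * (M / 4) := by gcongr; linarith
    have c4 : (incidenceCount P H' : ℝ) ≤
        22 * r * (L * (s / 2) + (M / 4) * (s / 2) + m * (M / 4)) :=
      ih'.trans (by gcongr)
    have c5 : (8 * (r : ℝ) + 2 * r * d + d) * L ≤ 11 * r * s * L := by
      gcongr
      nlinarith [mul_le_mul_of_nonneg_left hsd (by linarith : (0 : ℝ) ≤ r)]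
    have c6 : (4 * (d : ℝ) + m) * M ≤ (4 * s + m) * M := by gcongr
    have c7 : 0 ≤ M * s := by positivity
    have c8 : 0 ≤ (m : ℝ) * M := by positivity
    nlinarith

end IncidenceBound

section ScaledDifferences

open scoped Classical
open Polynomial

variable {K : Type*} [Field K]

theorem exists_forall_eval_ne_zero [Infinite K] (S : Finset K[X]) :
    ∃ s : K, ∀ f ∈ S, f ≠ 0 → f.eval s ≠ 0 := by
  obtain ⟨s, hs⟩ := Infinite.exists_notMem_finset (S.biUnion fun f => f.roots.toFinset)
  refine ⟨s, fun f hf hf0 h => hs ?_⟩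
  exact Finset.mem_biUnion.2 ⟨f, hf, by simpa [hf0] using h⟩

/-- The point of `K³` attached to `(c₁, z', c₄)`, with parameter `s`. -/
def diffPoint (s : K) (q : K × K × K) : K × K × K :=
  ((q.2.1 * q.2.2 + s ^ 2 * q.1) / (q.2.1 + s), 1 / (q.2.1 + s), q.1 / (q.2.1 + s))

/-- The plane of `K³` attached to `(z, c₃, c₂)`, with parameter `s`. -/
def diffPlane (s : K) (w : K × K × K) : K × K × K :=
  (1 / (s ^ 2 - w.1), (s * w.2.1 - w.1 * w.2.2) / (s ^ 2 - w.1), - w.2.1 / (s ^ 2 - w.1))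

theorem incidentTo_diff_iff {s : K} {q w : K × K × K} (hq : q.2.1 + s ≠ 0)
    (hw : s ^ 2 - w.1 ≠ 0) :
    IncidentTo (diffPoint s q) (diffPlane s w) ↔
      w.1 * (q.1 - w.2.2) = q.2.1 * (w.2.1 - q.2.2) := by
  obtain ⟨c₁, z', c₄⟩ := q
  obtain ⟨z, c₃, c₂⟩ := w
  simp only [IncidentTo, diffPoint, diffPlane] at *
  field_simp
  constructor <;> intro h <;> linear_combination -h

theorem coeff_cubic_eq_zero {a b c d : K} (h : C a + C b * X + C c * X ^ 2 + C d * X ^ 3 = 0) :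
    a = 0 ∧ b = 0 ∧ c = 0 ∧ d = 0 := by
  have h' := fun n => congrArg (fun f : K[X] => f.coeff n) h
  refine ⟨by simpa [coeff_X, coeff_X_pow] using h' 0, by simpa [coeff_X, coeff_X_pow] using h' 1,
    by simpa [coeff_X, coeff_X_pow] using h' 2, by simpa [coeff_X, coeff_X_pow] using h' 3⟩

/-- For a generic parameter the first coordinate of `diffPoint` and the second one of `diffPlane`
are injective. -/
theorem exists_generic_parameter [Infinite K] (P H : Finset (K × K × K))
    (hP : ∀ q ∈ P, q.2.1 ≠ 0 ∧ q.2.2 ≠ 0) (hH : ∀ w ∈ H, w.1 ≠ 0 ∧ w.2.2 ≠ 0) :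
    ∃ s : K, (∀ q ∈ P, q.2.1 + s ≠ 0) ∧ (∀ w ∈ H, s ^ 2 - w.1 ≠ 0) ∧
      Set.InjOn (fun q => (diffPoint s q).1) (P : Set (K × K × K)) ∧
      Set.InjOn (fun w => (diffPlane s w).2.1) (H : Set (K × K × K)) := by
  obtain ⟨s, hs⟩ := exists_forall_eval_ne_zero
    (P.image (fun q => C q.2.1 + C 1 * X + C 0 * X ^ 2 + C 0 * X ^ 3) ∪
      H.image (fun w => C (-w.1) + C 0 * X + C 1 * X ^ 2 + C 0 * X ^ 3) ∪
      (P ×ˢ P).image (fun x : (K × K × K) × K × K × K =>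
        C (x.1.2.1 * x.2.2.1 * (x.1.2.2 - x.2.2.2)) +
        C (x.1.2.1 * x.1.2.2 - x.2.2.1 * x.2.2.2) * X +
        C (x.1.1 * x.2.2.1 - x.2.1 * x.1.2.1) * X ^ 2 + C (x.1.1 - x.2.1) * X ^ 3) ∪
      (H ×ˢ H).image (fun x : (K × K × K) × K × K × K =>
        C (x.1.1 * x.2.1 * (x.1.2.2 - x.2.2.2)) +
        C (x.2.2.1 * x.1.1 - x.1.2.1 * x.2.1) * X +
        C (x.2.1 * x.2.2.2 - x.1.1 * x.1.2.2) * X ^ 2 + C (x.1.2.1 - x.2.2.1) * X ^ 3))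
  have hs1 : ∀ q ∈ P, q.2.1 + s ≠ 0 := by
    intro q hq h
    refine hs _ (Finset.mem_union_left _ (Finset.mem_union_left _ (Finset.mem_union_left _
      (Finset.mem_image_of_mem _ hq)))) (fun h0 => ?_) ?_
    · exact one_ne_zero (coeff_cubic_eq_zero h0).2.1
    · simpa using h
  have hs2 : ∀ w ∈ H, s ^ 2 - w.1 ≠ 0 := by
    intro w hw h
    refine hs _ (Finset.mem_union_left _ (Finset.mem_union_left _ (Finset.mem_union_right _
      (Finset.mem_image_of_mem _ hw)))) (fun h0 => ?_) ?_
    · exact one_ne_zero (coeff_cubic_eq_zero h0).2.2.1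
    · simp only [eval_add, eval_mul, eval_C, eval_X, eval_pow]
      linear_combination h
  refine ⟨s, hs1, hs2, ?_, ?_⟩
  · rintro ⟨c₁, z, c₄⟩ hq ⟨d₁, u, d₄⟩ hq' h
    have hz : z + s ≠ 0 := hs1 _ hq
    have hu : u + s ≠ 0 := hs1 _ hq'
    simp only [diffPoint] at h
    rw [div_eq_div_iff hz hu] at h
    by_contra hne
    refine hs _ (Finset.mem_union_left _ (Finset.mem_union_right _
      (Finset.mem_image_of_mem _ (Finset.mk_mem_product hq hq')))) (fun h0 => hne ?_) ?_
    · obtain ⟨e1, e2, -, e4⟩ := coeff_cubic_eq_zero h0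
      have hz0 : z ≠ 0 := (hP _ hq).1
      have hu0 : u ≠ 0 := (hP _ hq').1
      have hc0 : c₄ ≠ 0 := (hP _ hq).2
      simp only [mul_eq_zero, hz0, hu0, false_or, sub_eq_zero] at e1 e2 e4
      subst e1 e4
      rw [mul_right_cancel₀ hc0 e2]
    · simp only [eval_add, eval_mul, eval_C, eval_X, eval_pow]
      linear_combination h
  · rintro ⟨z, c₃, c₂⟩ hq ⟨u, d₃, d₂⟩ hq' h
    have hz : s ^ 2 - z ≠ 0 := hs2 _ hq
    have hu : s ^ 2 - u ≠ 0 := hs2 _ hq'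
    simp only [diffPlane] at h
    rw [div_eq_div_iff hz hu] at h
    by_contra hne
    refine hs _ (Finset.mem_union_right _
      (Finset.mem_image_of_mem _ (Finset.mk_mem_product hq hq'))) (fun h0 => hne ?_) ?_
    · obtain ⟨e1, -, e3, e4⟩ := coeff_cubic_eq_zero h0
      have hz0 : z ≠ 0 := (hH _ hq).1
      have hu0 : u ≠ 0 := (hH _ hq').1
      have hc0 : c₂ ≠ 0 := (hH _ hq).2
      simp only [mul_eq_zero, hz0, hu0, false_or, sub_eq_zero] at e1 e3 e4
      subst e1 e4
      rw [mul_right_cancel₀ hc0 e3]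
    · simp only [eval_add, eval_mul, eval_C, eval_X, eval_pow]
      linear_combination h

theorem card_common_solutions_le (A Y : Finset K) (hY : (0 : K) ∉ Y) {z c₃ c₂ u d₃ d₂ : K}
    (hz : z ≠ 0) (hne : (z, c₃, c₂) ≠ (u, d₃, d₂)) :
    ((A ×ˢ Y ×ˢ A).filter fun q => z * (q.1 - c₂) = q.2.1 * (c₃ - q.2.2) ∧
      u * (q.1 - d₂) = q.2.1 * (d₃ - q.2.2)).card ≤ A.card + Y.card := by
  by_cases h3 : c₃ = d₃
  · subst h3
    by_cases hu : z = u
    · subst hu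
      rw [Finset.card_eq_zero.2]
      · exact Nat.zero_le _
      refine Finset.filter_eq_empty_iff.2 fun q _ h => hne ?_
      have : z * (c₂ - d₂) = 0 := by linear_combination h.2 - h.1
      rw [mul_eq_zero, or_iff_right hz, sub_eq_zero] at this
      rw [this]
    · refine (Finset.card_le_card_of_injOn (fun q => q.2.1) (t := Y) ?_ ?_).trans
        (Nat.le_add_left _ _)
      · intro q hq
        simp only [Finset.coe_filter, Finset.mem_product, Set.mem_ofPred_eq] at hq
        exact hq.1.2.1
      · rintro ⟨a, y, b⟩ hq ⟨a', y', b'⟩ hq' h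
        simp only [Finset.coe_filter, Finset.mem_product, Set.mem_ofPred_eq] at hq hq' h
        subst h
        have hy : y ≠ 0 := fun h => hY (h ▸ hq.1.2.1)
        have e1 : a = a' := by
          apply mul_left_cancel₀ (sub_ne_zero.2 hu)
          linear_combination hq.2.1 - hq.2.2 - hq'.2.1 + hq'.2.2
        subst e1
        have e2 : b = b' := by
          apply mul_left_cancel₀ hy
          linear_combination hq.2.1 - hq'.2.1
        rw [e2]
  · refine (Finset.card_le_card_of_injOn (fun q => q.1) (t := A) ?_ ?_).trans
      (Nat.le_add_right _ _)
    · intro q hq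
      simp only [Finset.coe_filter, Finset.mem_product, Set.mem_ofPred_eq] at hq
      exact hq.1.1
    · rintro ⟨a, y, b⟩ hq ⟨a', y', b'⟩ hq' h
      simp only [Finset.coe_filter, Finset.mem_product, Set.mem_ofPred_eq] at hq hq' h
      subst h
      have hy : y ≠ 0 := fun h => hY (h ▸ hq.1.2.1)
      have e1 : y = y' := by
        apply mul_right_cancel₀ (sub_ne_zero.2 h3)
        linear_combination hq'.2.1 - hq'.2.2 - hq.2.1 + hq.2.2
      subst e1
      have e2 : b = b' := by
        apply mul_left_cancel₀ hy
        linear_combination hq.2.1 - hq'.2.1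
      rw [e2]

theorem sum_card_solutions_le [Infinite K] {p : ℕ} [CharP K p] {r : ℕ} (hr : 1296 ≤ r)
    (A Y : Finset K) (hA : (0 : K) ∉ A) (hY : (0 : K) ∉ Y)
    (hp : 54 * (A.card ^ 2 * Y.card) < r * p ^ 2) :
    ((∑ w ∈ Y ×ˢ A ×ˢ A, ((A ×ˢ Y ×ˢ A).filter fun q =>
      w.1 * (q.1 - w.2.2) = q.2.1 * (w.2.1 - q.2.2)).card : ℕ) : ℝ) ≤
      22 * r * (2 * (A.card ^ 2 * Y.card * √(A.card ^ 2 * Y.card)) +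
        (A.card + Y.card) * (A.card ^ 2 * Y.card)) := by
  have hA' : ∀ a ∈ A, a ≠ 0 := fun a ha h => hA (h ▸ ha)
  have hY' : ∀ a ∈ Y, a ≠ 0 := fun a ha h => hY (h ▸ ha)
  set P := A ×ˢ Y ×ˢ A with hPdef
  set H := Y ×ˢ A ×ˢ A with hHdef
  have hPc : P.card = A.card ^ 2 * Y.card := by
    simp only [hPdef, Finset.card_product]; ring
  have hHc : H.card = A.card ^ 2 * Y.card := by
    simp only [hHdef, Finset.card_product]; ring
  obtain ⟨s, hs1, hs2, hs3, hs4⟩ := exists_generic_parameter P H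
    (fun q hq => by
      simp only [hPdef, Finset.mem_product] at hq
      exact ⟨hY' _ hq.2.1, hA' _ hq.2.2⟩)
    (fun q hq => by
      simp only [hHdef, Finset.mem_product] at hq
      exact ⟨hY' _ hq.1, hA' _ hq.2.2⟩)
  have iP : Set.InjOn (diffPoint s) (P : Set (K × K × K)) :=
    fun x hx y hy h => hs3 hx hy (congrArg (fun t => t.1) h)
  have iH : Set.InjOn (diffPlane s) (H : Set (K × K × K)) :=
    fun x hx y hy h => hs4 hx hy (congrArg (fun t => t.2.1) h)
  have cP : (P.image (diffPoint s)).card = A.card ^ 2 * Y.card := by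
    rw [Finset.card_image_of_injOn iP, hPc]
  have cH : (H.image (diffPlane s)).card = A.card ^ 2 * Y.card := by
    rw [Finset.card_image_of_injOn iH, hHc]
  have key := incidenceCount_le (p := p) (m := A.card + Y.card) hr
    (P := P.image (diffPoint s)) ?_ (H.image (diffPlane s)) ?_ ?_ (by rwa [cH])
  · rw [cP, cH] at key
    have e : incidenceCount (P.image (diffPoint s)) (H.image (diffPlane s)) =
        ∑ w ∈ H, (P.filter fun q => w.1 * (q.1 - w.2.2) = q.2.1 * (w.2.1 - q.2.2)).card := by
      rw [incidenceCount, Finset.sum_image iH]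
      refine Finset.sum_congr rfl fun w hw => ?_
      rw [Finset.filter_image, Finset.card_image_of_injOn
        (iP.mono (Finset.coe_subset.2 (Finset.filter_subset _ _)))]
      congr 1
      exact Finset.filter_congr fun q hq => incidentTo_diff_iff (hs1 q hq) (hs2 w hw)
    rw [← e]
    refine key.trans (le_of_eq ?_)
    push_cast
    ring
  · intro x hx y hy h
    obtain ⟨q, hq, rfl⟩ := Finset.mem_image.1 hx
    obtain ⟨q', hq', rfl⟩ := Finset.mem_image.1 hy
    rw [hs3 hq hq' h]
  · intro x hx y hy h
    obtain ⟨q, hq, rfl⟩ := Finset.mem_image.1 hx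
    obtain ⟨q', hq', rfl⟩ := Finset.mem_image.1 hy
    rw [hs4 hq hq' h]
  · intro x hx y hy hne
    obtain ⟨w, hw, rfl⟩ := Finset.mem_image.1 hx
    obtain ⟨w', hw', rfl⟩ := Finset.mem_image.1 hy
    rw [Finset.filter_image]
    refine Finset.card_image_le.trans ?_
    have hww : w ≠ w' := fun h => hne (h ▸ rfl)
    refine (Finset.card_le_card ?_).trans
      (card_common_solutions_le A Y hY (hY' _ (Finset.mem_product.1 hw).1) hww)
    intro q hq
    obtain ⟨hq, h1, h2⟩ := Finset.mem_filter.1 hq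
    exact Finset.mem_filter.2 ⟨hq, (incidentTo_diff_iff (hs1 q hq) (hs2 _ hw)).1 h1,
      (incidentTo_diff_iff (hs1 q hq) (hs2 _ hw')).1 h2⟩

end ScaledDifferences

section Energy

open scoped Classical

theorem card_filter_eq_sum_mul {α β γ : Type*} [Fintype γ] (P : Finset α) (Q : Finset β)
    (f : α → γ) (g : β → γ) :
    ((P ×ˢ Q).filter fun x => f x.1 = g x.2).card =
      ∑ c, (P.filter fun a => f a = c).card * (Q.filter fun b => g b = c).card := by
  rw [Finset.card_eq_sum_card_fiberwise (f := fun x => f x.1) (t := Finset.univ)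
    (fun _ _ => Finset.mem_coe.2 (Finset.mem_univ _))]
  refine Finset.sum_congr rfl fun c _ => ?_
  rw [← Finset.card_product]
  congr 1
  ext ⟨a, b⟩
  simp only [Finset.mem_filter, Finset.mem_product]
  constructor
  · rintro ⟨⟨⟨ha, hb⟩, h⟩, rfl⟩
    exact ⟨⟨ha, rfl⟩, hb, h.symm⟩
  · rintro ⟨⟨ha, rfl⟩, hb, h⟩
    exact ⟨⟨⟨ha, hb⟩, h.symm⟩, rfl⟩

theorem sum_card_filter_eq {α β : Type*} (P : Finset α) (Q : Finset β) (R : α → β → Prop) :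
    ∑ a ∈ P, (Q.filter fun b => R a b).card = ((P ×ˢ Q).filter fun x => R x.1 x.2).card := by
  simp only [Finset.card_filter, Finset.sum_product]

variable {F : Type*} [Field F]

/-- The number of solutions of `z (a - b) = z' (a' - b')` with `z, z' ∈ Y` and
`a, b, a', b' ∈ A`. -/
noncomputable def scaledEnergy (A Y : Finset F) : ℕ :=
  (((Y ×ˢ A ×ˢ A) ×ˢ (Y ×ˢ A ×ˢ A)).filter fun x =>
    x.1.1 * (x.1.2.1 - x.1.2.2) = x.2.1 * (x.2.2.1 - x.2.2.2)).card

theorem scaledEnergy_le {p : ℕ} [CharP F p] {r : ℕ} (hr : 1296 ≤ r)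
    (A Y : Finset F) (hY : (0 : F) ∉ Y) (hp : 54 * (A.card ^ 2 * Y.card) < r * p ^ 2) :
    (scaledEnergy A Y : ℝ) ≤ 22 * r * (2 * (A.card ^ 2 * Y.card * √(A.card ^ 2 * Y.card)) +
        (A.card + Y.card) * (A.card ^ 2 * Y.card)) := by
  let φ : F →+* AlgebraicClosure F := algebraMap F _
  have : CharP (AlgebraicClosure F) p := charP_of_injective_ringHom φ.injective p
  have : Infinite (AlgebraicClosure F) := IsAlgClosed.instInfinite
  obtain ⟨t, ht⟩ := Infinite.exists_notMem_finset (A.image fun a => - φ a)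
  let γ : F → AlgebraicClosure F := fun a => φ a + t
  have hγ : Function.Injective γ := fun a b h => φ.injective (add_right_cancel h)
  have h0 : (0 : AlgebraicClosure F) ∉ A.image γ := by
    intro h
    obtain ⟨a, ha, h⟩ := Finset.mem_image.1 h
    exact ht (Finset.mem_image.2 ⟨a, ha, neg_eq_of_add_eq_zero_right h⟩)
  have h1 : (0 : AlgebraicClosure F) ∉ Y.image φ := by
    intro h
    obtain ⟨a, ha, h⟩ := Finset.mem_image.1 h
    exact hY ((map_eq_zero φ).1 h ▸ ha)
  have key := sum_card_solutions_le (p := p) hr (A.image γ) (Y.image φ) h0 h1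
    (by rwa [Finset.card_image_of_injective _ hγ, Finset.card_image_of_injective _ φ.injective])
  rw [Finset.card_image_of_injective _ hγ, Finset.card_image_of_injective _ φ.injective] at key
  refine le_trans (Nat.cast_le.2 ?_) key
  rw [sum_card_filter_eq, scaledEnergy]
  refine Finset.card_le_card_of_injOn (fun x => ((φ x.1.1, γ x.2.2.1, γ x.1.2.2),
    (γ x.1.2.1, φ x.2.1, γ x.2.2.2))) ?_ ?_
  · rintro ⟨⟨z, a, b⟩, ⟨z', a', b'⟩⟩ h
    simp only [Finset.coe_filter, Finset.mem_product, Set.mem_ofPred_eq] at h ⊢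
    obtain ⟨⟨⟨hz, ha, hb⟩, hz', ha', hb'⟩, h⟩ := h
    refine ⟨⟨⟨Finset.mem_image_of_mem _ hz, Finset.mem_image_of_mem _ ha',
      Finset.mem_image_of_mem _ hb⟩, Finset.mem_image_of_mem _ ha, Finset.mem_image_of_mem _ hz',
      Finset.mem_image_of_mem _ hb'⟩, ?_⟩
    have := congrArg φ h
    simp only [map_mul, map_sub] at this
    simp only [γ]
    linear_combination this
  · rintro ⟨⟨z, a, b⟩, ⟨z', a', b'⟩⟩ - ⟨⟨u, c, d⟩, ⟨u', c', d'⟩⟩ - h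
    simp only [Prod.mk.injEq] at h ⊢
    obtain ⟨⟨e1, e2, e3⟩, e4, e5, e6⟩ := h
    exact ⟨⟨φ.injective e1, hγ e4, hγ e3⟩, φ.injective e5, hγ e2, hγ e6⟩

theorem scaledEnergy_le_of_card_le {p : ℕ} [CharP F p] {r : ℕ} (hr : 1296 ≤ r) {c : ℝ}
    (A Y : Finset F) (hY : (0 : F) ∉ Y) (hp : 54 * (A.card ^ 2 * Y.card) < r * p ^ 2)
    (hc : (Y.card : ℝ) ≤ c * (A.card : ℝ) ^ 2) :
    (scaledEnergy A Y : ℝ) ≤ 22 * r * (3 + √c) * ((A.card : ℝ) ^ 3 * (Y.card * √Y.card)) := by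
  refine (scaledEnergy_le hr A Y hY hp).trans ?_
  rw [mul_assoc _ (3 + √c)]
  refine mul_le_mul_of_nonneg_left ?_ (by positivity)
  have hn : (0 : ℝ) ≤ A.card := Nat.cast_nonneg _
  have hk : (0 : ℝ) ≤ Y.card := Nat.cast_nonneg _
  set n : ℝ := (A.card : ℝ)
  have e1 : √(n ^ 2 * Y.card) = n * √Y.card := by
    rw [Real.sqrt_mul (by positivity), Real.sqrt_sq hn]
  have e2 : √Y.card ≤ √c * n := by
    calc √Y.card ≤ √(c * n ^ 2) := Real.sqrt_le_sqrt hc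
      _ = √c * n := by rw [Real.sqrt_mul' _ (by positivity), Real.sqrt_sq hn]
  have e3 : (Y.card : ℝ) ≤ Y.card * √Y.card := by
    rcases Nat.eq_zero_or_pos Y.card with h | h
    · simp [h]
    · exact le_mul_of_one_le_right hk (Real.one_le_sqrt.2 (by exact_mod_cast h))
  have e4 : √(Y.card : ℝ) * √(Y.card : ℝ) = Y.card := Real.mul_self_sqrt hk
  have e5 : (Y.card : ℝ) * n ^ 2 * Y.card ≤ √c * (n ^ 3 * (Y.card * √Y.card)) := by
    calc (Y.card : ℝ) * n ^ 2 * Y.card = Y.card * n ^ 2 * √Y.card * √Y.card := by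
          rw [mul_assoc _ (√(Y.card : ℝ)), e4]
      _ ≤ Y.card * n ^ 2 * √Y.card * (√c * n) := by gcongr
      _ = _ := by ring
  have e6 : n ^ 3 * Y.card ≤ n ^ 3 * (Y.card * √Y.card) := by gcongr
  rw [e1]
  linarith

theorem addEnergy2_image_mul_le (A : Finset F) {y : F} (hy : y ≠ 0) :
    addEnergy2 (A : Set F) ((fun x => y * x) '' A) ≤
      (((A ×ˢ A) ×ˢ (A ×ˢ A)).filter fun x => x.1.1 - x.1.2 = y * (x.2.1 - x.2.2)).card := by
  rw [addEnergy2, ← Set.ncard_coe_finset]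
  refine Set.ncard_le_ncard_of_injOn
    (fun t => ((t.1, t.2.2.1), (y⁻¹ * t.2.2.2, y⁻¹ * t.2.1))) ?_ ?_ (Finset.finite_toSet _)
  · rintro ⟨a, b, c, d⟩ ⟨ha, ⟨b, hb, rfl⟩, hc, ⟨d, hd, rfl⟩, h⟩
    simp only [Finset.coe_filter, Finset.mem_product, Set.mem_ofPred_eq,
      inv_mul_cancel_left₀ hy] at h ⊢
    exact ⟨⟨⟨ha, hc⟩, hd, hb⟩, by linear_combination h⟩
  · rintro ⟨a, b, c, d⟩ - ⟨a', b', c', d'⟩ - h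
    simp only [Prod.mk.injEq, mul_right_inj' (inv_ne_zero hy)] at h ⊢
    tauto

theorem card_sub_eq_sub_le_addEnergy (A : Finset F) :
    (((A ×ˢ A) ×ˢ (A ×ˢ A)).filter fun x => x.1.1 - x.1.2 = x.2.1 - x.2.2).card ≤
      addEnergy (A : Set F) := by
  rw [addEnergy, addEnergy2, ← Set.ncard_coe_finset]
  refine Set.ncard_le_ncard_of_injOn (fun x => (x.1.1, x.2.2, x.2.1, x.1.2)) ?_ ?_ ?_
  · rintro ⟨⟨a, b⟩, c, d⟩ h
    simp only [Finset.coe_filter, Finset.mem_product, Set.mem_ofPred_eq, Finset.mem_coe] at h ⊢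
    exact ⟨h.1.1.1, h.1.2.2, h.1.2.1, h.1.1.2, by linear_combination h.2⟩
  · rintro ⟨⟨a, b⟩, c, d⟩ - ⟨⟨a', b'⟩, c', d'⟩ - h
    simp only [Prod.mk.injEq] at h ⊢
    tauto
  · refine (Finset.finite_toSet (A ×ˢ A ×ˢ A ×ˢ A)).subset ?_
    rintro ⟨a, b, c, d⟩ ⟨ha, hb, hc, hd, -⟩
    simpa using ⟨ha, hb, hc, hd⟩

theorem sq_sum_addEnergy2_le [Fintype F] (A Y : Finset F) (hY : (0 : F) ∉ Y) :
    (∑ y ∈ Y, addEnergy2 (A : Set F) ((fun x => y * x) '' A)) ^ 2 ≤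
      addEnergy (A : Set F) * scaledEnergy A Y := by
  have h1 : ∑ y ∈ Y, addEnergy2 (A : Set F) ((fun x => y * x) '' A) ≤
      (((A ×ˢ A) ×ˢ (Y ×ˢ A ×ˢ A)).filter fun x =>
        x.1.1 - x.1.2 = x.2.1 * (x.2.2.1 - x.2.2.2)).card := by
    refine (Finset.sum_le_sum fun y hy => addEnergy2_image_mul_le A
      (fun h => hY (h ▸ hy))).trans ?_
    rw [sum_card_filter_eq Y ((A ×ˢ A) ×ˢ (A ×ˢ A))
      fun y x => x.1.1 - x.1.2 = y * (x.2.1 - x.2.2)]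
    refine Finset.card_le_card_of_injOn (fun x => (x.2.1, (x.1, x.2.2))) ?_ ?_
    · rintro ⟨y, u, v⟩ h
      simp only [Finset.coe_filter, Finset.mem_product, Set.mem_ofPred_eq] at h ⊢
      tauto
    · rintro ⟨y, u, v⟩ - ⟨y', u', v'⟩ - h
      simp only [Prod.mk.injEq] at h ⊢
      tauto
  refine (Nat.pow_le_pow_left h1 2).trans ?_
  rw [card_filter_eq_sum_mul (A ×ˢ A) (Y ×ˢ A ×ˢ A) (fun a => a.1 - a.2)
    fun x => x.1 * (x.2.1 - x.2.2)]
  refine (Finset.sum_mul_sq_le_sq_mul_sq _ _ _).trans ?_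
  refine Nat.mul_le_mul (le_trans (le_of_eq ?_) (card_sub_eq_sub_le_addEnergy A)) (le_of_eq ?_)
  · rw [card_filter_eq_sum_mul (A ×ˢ A) (A ×ˢ A) (fun a => a.1 - a.2) fun a => a.1 - a.2]
    simp only [sq]
  · rw [scaledEnergy, card_filter_eq_sum_mul (Y ×ˢ A ×ˢ A) (Y ×ˢ A ×ˢ A)
      (fun x => x.1 * (x.2.1 - x.2.2)) fun x => x.1 * (x.2.1 - x.2.2)]
    simp only [sq]

end Energy

/-- Rudnev's energy bound: if $|Y| \le c_1 |C|^2$ and $|C|^2 |Y| \le c_2 p^2$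
with $Y \subseteq F_p^*$, then $\sum_{y \in Y} E^+(C, yC) \le K E^+(C)^{1/2} |C|^{3/2} |Y|^{3/4}$. -/
theorem statement14 :
    ∀ c₁ c₂ : ℝ, 0 < c₁ → 0 < c₂ →
      ∃ K : ℝ, 0 < K ∧
        ∀ (p : ℕ) [Fact p.Prime] (C : Set (ZMod p)) (Y : Finset (ZMod p)),
          (0 : ZMod p) ∉ Y →
          (Y.card : ℝ) ≤ c₁ * (C.ncard : ℝ) ^ (2 : ℕ) →
          (C.ncard : ℝ) ^ (2 : ℕ) * (Y.card : ℝ) ≤ c₂ * (p : ℝ) ^ (2 : ℕ) →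
          (∑ y ∈ Y, (addEnergy2 C ((fun x => y * x) '' C) : ℝ)) ≤
            K * (addEnergy C : ℝ) ^ (1/2 : ℝ) * (C.ncard : ℝ) ^ (3/2 : ℝ) *
              (Y.card : ℝ) ^ (3/4 : ℝ) := by
  intro c₁ c₂ h₁ h₂
  obtain ⟨r, hr⟩ := exists_nat_gt (max 1296 (54 * c₂))
  have hr1 : 1296 ≤ r := by
    have := (le_max_left _ _).trans hr.le
    exact_mod_cast this
  have hr2 : 54 * c₂ < r := (le_max_right _ _).trans_lt hr
  have hB : 0 < 22 * (r : ℝ) * (3 + √c₁) := by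
    have : (0 : ℝ) < r := by exact_mod_cast (by omega : 0 < r)
    positivity
  refine ⟨√(22 * r * (3 + √c₁)), Real.sqrt_pos.2 hB, ?_⟩
  intro p _ C Y hY hc hp
  obtain ⟨A, rfl⟩ : ∃ A : Finset (ZMod p), (A : Set (ZMod p)) = C :=
    ⟨C.toFinite.toFinset, C.toFinite.coe_toFinset⟩
  rw [Set.ncard_coe_finset] at hc hp ⊢
  have hp' : 54 * (A.card ^ 2 * Y.card) < r * p ^ 2 := by
    have hp0 : (0 : ℝ) < (p : ℝ) ^ 2 := by
      have : (0 : ℝ) < p := by exact_mod_cast (Fact.out : p.Prime).pos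
      positivity
    have : 54 * ((A.card : ℝ) ^ 2 * Y.card) < r * (p : ℝ) ^ 2 := by nlinarith
    exact_mod_cast this
  have hN := scaledEnergy_le_of_card_le (p := p) hr1 A Y hY hp' hc
  have hS : (∑ y ∈ Y, (addEnergy2 (A : Set (ZMod p)) ((fun x => y * x) '' A) : ℝ)) ^ 2 ≤
      addEnergy (A : Set (ZMod p)) * scaledEnergy A Y := by
    exact_mod_cast sq_sum_addEnergy2_le A Y hY
  refine (abs_le_of_sq_le_sq' (hS.trans ?_) (by positivity)).2
  have e1 : ((addEnergy (A : Set (ZMod p)) : ℝ) ^ (1 / 2 : ℝ)) ^ 2 =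
      addEnergy (A : Set (ZMod p)) := by
    rw [← Real.sqrt_eq_rpow, Real.sq_sqrt (Nat.cast_nonneg _)]
  have e2 : ((A.card : ℝ) ^ (3 / 2 : ℝ)) ^ 2 = (A.card : ℝ) ^ 3 := by
    rw [← Real.rpow_mul_natCast (Nat.cast_nonneg _), ← Real.rpow_natCast]
    norm_num
  have e3 : ((Y.card : ℝ) ^ (3 / 4 : ℝ)) ^ 2 = Y.card * √Y.card := by
    rw [← Real.rpow_mul_natCast (Nat.cast_nonneg _), Real.sqrt_eq_rpow,
      ← Real.rpow_one_add' (Nat.cast_nonneg _) (by norm_num)]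
    norm_num
  rw [mul_pow, mul_pow, mul_pow, e1, e2, e3, Real.sq_sqrt hB.le]
  calc (addEnergy (A : Set (ZMod p)) : ℝ) * scaledEnergy A Y
      ≤ addEnergy (A : Set (ZMod p)) *
        (22 * r * (3 + √c₁) * ((A.card : ℝ) ^ 3 * (Y.card * √Y.card))) := by gcongr
    _ = _ := by ring
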